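/- arXiv:1912.09911 — 2 statements merged into one kernel-verified Lean document; each statement's English description precedes it below -/
import Mathlib

section
/- Let σ and τ be faces of the fundamental alcove 𝐚_f containing the origin, let x, y ∈ W and s ∈ S with ℓ(ys) > ℓ(y), let H be the unique hyperplane separating the adjacent alcoves y·𝐚_f and ys·𝐚_f (the supporting hyperplane of their common panel), let r_H be the reflection in H, and let H^{ys} be the closed half-space bounded by H containing ys·𝐚_f. Then Sh_{𝐲𝐬}(xτ,σ) = Sh_𝐲(xτ,σ) ∪ r_H({ζ ∈ Sh_𝐲(xτ,σ) : ζ ⊆ H^{ys}}), where Sh_{𝐲𝐬} denotes the shadow with respect to the orientation φ_{𝐲𝐬} induced by the alcove ys·𝐚_f. -/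
open scoped RealInnerProductSpace
open scoped Classical

noncomputable section

/-- The ambient Euclidean space `V = ℝⁿ`. -/
abbrev V (n : ℕ) : Type := EuclideanSpace ℝ (Fin n)

/-- The data of an irreducible crystallographic (reduced) root system in `ℝⁿ`,
together with a choice of positive roots, simple roots and highest root. -/
structure RootData (n : ℕ) where
  Φ : Set (V n)
  pos : Set (V n)
  simple : Fin n → V n
  highest : V n
  finite : Φ.Finite
  nonzero : ∀ α ∈ Φ, α ≠ 0
  neg_mem : ∀ α ∈ Φ, -α ∈ Φ
  span_top : Submodule.span ℝ Φ = ⊤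
  reflect_mem : ∀ α ∈ Φ, ∀ β ∈ Φ, β - (2 * ⟪α, β⟫ / ⟪α, α⟫) • α ∈ Φ
  crystallographic : ∀ α ∈ Φ, ∀ β ∈ Φ, ∃ m : ℤ, 2 * ⟪α, β⟫ / ⟪α, α⟫ = (m : ℝ)
  reduced : ∀ α ∈ Φ, ∀ c : ℝ, c • α ∈ Φ → c = 1 ∨ c = -1
  pos_sub : pos ⊆ Φ
  pos_total : ∀ α ∈ Φ, α ∈ pos ∨ -α ∈ pos
  pos_not_neg : ∀ α ∈ pos, -α ∉ pos
  simple_mem : ∀ i, simple i ∈ pos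
  simple_indep : LinearIndependent ℝ simple
  pos_combo : ∀ α ∈ pos, ∃ c : Fin n → ℝ, (∀ i, 0 ≤ c i) ∧ α = ∑ i, c i • simple i
  highest_mem : highest ∈ pos
  highest_dominates : ∀ α ∈ pos, ∃ c : Fin n → ℝ, (∀ i, 0 ≤ c i) ∧
    highest - α = ∑ i, c i • simple i
  irreducible : ∀ A B : Set (Fin n), A ∪ B = Set.univ → A ∩ B = ∅ →
    (∀ i ∈ A, ∀ j ∈ B, ⟪simple i, simple j⟫ = 0) → A = ∅ ∨ B = ∅

variable {n : ℕ}

/-- The coroot `α^∨ = 2α/⟨α,α⟩`. -/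
def coroot (α : V n) : V n := (2 / ⟪α, α⟫) • α

/-- The affine hyperplane `H_{α,k} = {v : ⟨α,v⟩ = k}`. -/
def Hy (α : V n) (k : ℝ) : Set (V n) := {v | ⟪α, v⟫ = k}

/-- The closed half-space `{v : ⟨α,v⟩ ≥ k}`. -/
def Hge (α : V n) (k : ℝ) : Set (V n) := {v | k ≤ ⟪α, v⟫}

/-- The closed half-space `{v : ⟨α,v⟩ ≤ k}`. -/
def Hle (α : V n) (k : ℝ) : Set (V n) := {v | ⟪α, v⟫ ≤ k}

/-- The affine reflection `s_{α,k}` fixing `H_{α,k}` pointwise. -/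
def sRefl (α : V n) (k : ℝ) : V n → V n := fun v => v - (⟪α, v⟫ - k) • coroot α

/-- The coroot lattice `R^∨ = ⊕ᵢ ℤ αᵢ^∨`. -/
def corootLattice (D : RootData n) : Set (V n) :=
  {μ | ∃ c : Fin n → ℤ, μ = ∑ i, (c i : ℝ) • coroot (D.simple i)}

/-- The affine Weyl group `W`, as the group of permutations of `V` generated by all
affine reflections `s_{α,k}` with `α ∈ Φ`, `k ∈ ℤ`. -/
def AffW (D : RootData n) : Subgroup (Equiv.Perm (V n)) :=
  Subgroup.closure {e : Equiv.Perm (V n) | ∃ α ∈ D.Φ, ∃ k : ℤ, ⇑e = sRefl α (k : ℝ)}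

/-- The finite Weyl group `W₀`, generated by the linear reflections `s_{α,0}`. -/
def FinW (D : RootData n) : Subgroup (Equiv.Perm (V n)) :=
  Subgroup.closure {e : Equiv.Perm (V n) | ∃ α ∈ D.Φ, ⇑e = sRefl α 0}

/-- The Coxeter generating set `S = {s₀, s₁, …, sₙ}` of the affine Weyl group. -/
def SGen (D : RootData n) : Set (AffW D) :=
  {s | ⇑(s : Equiv.Perm (V n)) = sRefl D.highest 1 ∨
       ∃ i : Fin n, ⇑(s : Equiv.Perm (V n)) = sRefl (D.simple i) 0}

/-- The Coxeter length of `y ∈ W` with respect to `S`. -/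
def lenW (D : RootData n) (y : AffW D) : ℕ :=
  sInf {m | ∃ l : List (AffW D), (∀ s ∈ l, s ∈ SGen D) ∧ l.length = m ∧ l.prod = y}

/-- The fundamental alcove `𝐚_f`. -/
def fund (D : RootData n) : Set (V n) :=
  {v | (∀ i, 0 ≤ ⟪D.simple i, v⟫) ∧ ⟪D.highest, v⟫ ≤ 1}

/-- The union of all the hyperplanes `H_{α,k}`. -/
def wallUnion (D : RootData n) : Set (V n) := ⋃ α ∈ D.Φ, ⋃ k : ℤ, Hy α (k : ℝ)

/-- An alcove: the closure of a connected component of the complement of all walls. -/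
def IsAlcove (D : RootData n) (c : Set (V n)) : Prop :=
  ∃ v ∈ (wallUnion D)ᶜ, c = closure (connectedComponentIn (wallUnion D)ᶜ v)

/-- A (closed) face of the Coxeter complex: the closure of an equivalence class of points
having the same position relative to every hyperplane of the arrangement. -/
def IsFace (D : RootData n) (F : Set (V n)) : Prop :=
  ∃ v : V n, F = closure {w | ∀ α ∈ D.Φ, ∀ k : ℤ,
    (⟪α, w⟫ = (k : ℝ) ↔ ⟪α, v⟫ = (k : ℝ)) ∧ (⟪α, w⟫ < (k : ℝ) ↔ ⟪α, v⟫ < (k : ℝ))}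

/-- The set of all hyperplanes of the affine arrangement, as subsets of `V`. -/
def hyperplanes (D : RootData n) : Set (Set (V n)) :=
  {H | ∃ α ∈ D.Φ, ∃ k : ℤ, H = Hy α (k : ℝ)}

/-- `p` is a panel (codimension-one face) of the alcove `c`: it is the intersection of `c`
with a wall, and it lies in exactly one hyperplane (its supporting hyperplane). -/
def IsPanelOf (D : RootData n) (p c : Set (V n)) : Prop :=
  IsAlcove D c ∧ IsFace D p ∧ (∃ H ∈ hyperplanes D, p = c ∩ H) ∧
    ∃! H, H ∈ hyperplanes D ∧ p ⊆ H

/-- The action of an element of the affine Weyl group on subsets of `V`. -/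
def actW {D : RootData n} (x : AffW D) (A : Set (V n)) : Set (V n) :=
  ⇑(x : Equiv.Perm (V n)) '' A

/-- The data of a finite combinatorial gallery `(p₀, c₀, p₁, …, p_l, c_l, p_{l+1})`:
`len = l`, alcoves `c 0, …, c len` and faces `p 0, …, p (len+1)`. -/
structure PreGallery (n : ℕ) where
  len : ℕ
  p : ℕ → Set (V n)
  c : ℕ → Set (V n)

/-- The gallery conditions for the data of a combinatorial gallery. -/
def IsGallery (D : RootData n) (γ : PreGallery n) : Prop :=
  (∀ i ≤ γ.len, IsAlcove D (γ.c i)) ∧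
  (IsFace D (γ.p 0) ∧ γ.p 0 ⊆ γ.c 0) ∧
  (IsFace D (γ.p (γ.len + 1)) ∧ γ.p (γ.len + 1) ⊆ γ.c γ.len) ∧
  ∀ i, 1 ≤ i → i ≤ γ.len → IsPanelOf D (γ.p i) (γ.c (i - 1)) ∧ IsPanelOf D (γ.p i) (γ.c i)

/-- A gallery is positively folded with respect to an orientation `φ` if whenever it has a
fold at `pᵢ` (i.e. `c_{i-1} = c_i`), `φ(cᵢ, pᵢ) = +`. -/
def PositivelyFolded (φ : Set (V n) → Set (V n) → Prop) (γ : PreGallery n) : Prop :=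
  ∀ i, 1 ≤ i → i ≤ γ.len → γ.c (i - 1) = γ.c i → φ (γ.c i) (γ.p i)

/-- `X` and `Y` lie in a common closed half-space bounded by `H_{α,k}`. -/
def sameSide (α : V n) (k : ℝ) (X Y : Set (V n)) : Prop :=
  (X ⊆ Hge α k ∧ Y ⊆ Hge α k) ∨ (X ⊆ Hle α k ∧ Y ⊆ Hle α k)

/-- The hyperplane `H_{α,k}` separates `X` from `Y` (they lie in opposite closed
half-spaces). -/
def Separates (α : V n) (k : ℝ) (X Y : Set (V n)) : Prop :=
  (X ⊆ Hge α k ∧ Y ⊆ Hle α k) ∨ (X ⊆ Hle α k ∧ Y ⊆ Hge α k)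

/-- The orientation induced by an alcove `A`: `φ(c,p) = +` iff the closed half-space bounded
by the supporting hyperplane of `p` which contains `c` does not contain `A`. -/
def alcoveOrient (D : RootData n) (A : Set (V n)) : Set (V n) → Set (V n) → Prop :=
  fun c p => ∀ α ∈ D.Φ, ∀ k : ℤ, p ⊆ Hy α (k : ℝ) → ¬ sameSide α (k : ℝ) c A

/-- Two faces have the same type iff they lie in the same orbit of the affine Weyl group. -/
def SameTypeFace (D : RootData n) (σ σ' : Set (V n)) : Prop :=
  ∃ x : Equiv.Perm (V n), x ∈ AffW D ∧ σ' = ⇑x '' σ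

/-- Two galleries have the same type iff they have the same length and corresponding
faces (first face, panels, last face) have the same types. -/
def SameTypeGallery (D : RootData n) (γ γ' : PreGallery n) : Prop :=
  γ.len = γ'.len ∧ ∀ i ≤ γ.len + 1, SameTypeFace D (γ.p i) (γ'.p i)

/-- A gallery is minimal if it has minimal length among all galleries with the same first
and last faces. -/
def IsMinimal (D : RootData n) (γ : PreGallery n) : Prop :=
  IsGallery D γ ∧ ∀ γ' : PreGallery n, IsGallery D γ' → γ'.p 0 = γ.p 0 →
    γ'.p (γ'.len + 1) = γ.p (γ.len + 1) → γ.len ≤ γ'.len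

/-- The shadow with respect to the orientation `φ`, relative to a fixed (minimal) gallery
`γ`: the set of final simplices of all galleries of the same type as `γ`, with the same
first face, which are positively folded with respect to `φ`. -/
def Shadow (D : RootData n) (φ : Set (V n) → Set (V n) → Prop) (γ : PreGallery n) :
    Set (Set (V n)) :=
  {ζ | ∃ γ' : PreGallery n, IsGallery D γ' ∧ SameTypeGallery D γ γ' ∧ γ'.p 0 = γ.p 0 ∧
    PositivelyFolded φ γ' ∧ ζ = γ'.p (γ'.len + 1)}

/-- The vertex version of the shadow: the set of points `μ` whose corresponding vertex
(the singleton face `{μ}`) is a final simplex of a positively folded gallery of the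
appropriate type. -/
def VShadow (D : RootData n) (φ : Set (V n) → Set (V n) → Prop) (γ : PreGallery n) :
    Set (V n) :=
  {μ | ({μ} : Set (V n)) ∈ Shadow D φ γ}

/-- The orbit `W₀ · λ` of a point under the finite Weyl group. -/
def W0orbit (D : RootData n) (lam : V n) : Set (V n) :=
  {v | ∃ w ∈ FinW D, v = w lam}

/-- The closed half-space bounded by `H_{α,k}` which contains the fundamental alcove. -/
def HalfId (D : RootData n) (α : V n) (k : ℝ) : Set (V n) :=
  if fund D ⊆ Hge α k then Hge α k else Hle α k

/-- `[j,m]` is a (finite) `H_{α,k}`-protrusion of `γ`. -/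
def IsProtrusionFin (D : RootData n) (γ : PreGallery n) (α : V n) (k : ℝ) (j m : ℕ) : Prop :=
  j < m ∧ m ≤ γ.len + 1 ∧ γ.p j ⊆ Hy α k ∧ γ.p m ⊆ Hy α k ∧
    ∀ i, j ≤ i → i < m → ¬ γ.c i ⊆ HalfId D α k

/-- `[j,∞)` is an (infinite) `H_{α,k}`-protrusion of `γ`. -/
def IsProtrusionInf (D : RootData n) (γ : PreGallery n) (α : V n) (k : ℝ) (j : ℕ) : Prop :=
  j ≤ γ.len + 1 ∧ γ.p j ⊆ Hy α k ∧ ∀ i, j ≤ i → i ≤ γ.len → ¬ γ.c i ⊆ HalfId D α k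

/-- The set of indices reflected by the maximal `H`-outcrop: the union of (the index sets
of) all `H`-protrusions. -/
def maxOutcrop (D : RootData n) (γ : PreGallery n) (α : V n) (k : ℝ) : Set ℕ :=
  {i | (∃ j m, IsProtrusionFin D γ α k j m ∧ j ≤ i ∧ i < m) ∨
       (∃ j, IsProtrusionInf D γ α k j ∧ j ≤ i)}

/-- `[j,m]` is a (finite) `H_{α,k}`-indentation of `γ`. -/
def IsIndentationFin (D : RootData n) (γ : PreGallery n) (α : V n) (k : ℝ) (j m : ℕ) : Prop :=
  1 ≤ j ∧ j < m ∧ m ≤ γ.len + 1 ∧ γ.p j ⊆ Hy α k ∧ γ.p m ⊆ Hy α k ∧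
    ∀ i, j ≤ i → i < m → γ.c i ⊆ HalfId D α k

/-- `[j,∞)` is an (infinite) `H_{α,k}`-indentation of `γ`. -/
def IsIndentationInf (D : RootData n) (γ : PreGallery n) (α : V n) (k : ℝ) (j : ℕ) : Prop :=
  1 ≤ j ∧ j ≤ γ.len + 1 ∧ γ.p j ⊆ Hy α k ∧ ∀ i, j ≤ i → i ≤ γ.len → γ.c i ⊆ HalfId D α k

/-- The set of indices reflected by the maximal `H`-ingrowth: the union of (the index sets
of) all `H`-indentations. -/
def maxIngrowth (D : RootData n) (γ : PreGallery n) (α : V n) (k : ℝ) : Set ℕ :=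
  {i | (∃ j m, IsIndentationFin D γ α k j m ∧ j ≤ i ∧ i < m) ∨
       (∃ j, IsIndentationInf D γ α k j ∧ j ≤ i)}

/-- The operators `e_H^L` and `f_H^L`: reflect in `H_{α,k}` those alcoves (and the faces
in between) whose indices belong to `L`.  (Since the bounding faces of a protrusion or
indentation lie in `H`, they are fixed pointwise by the reflection, so this uniform
description agrees with the usual one.) -/
def flipGallery (α : V n) (k : ℝ) (L : Set ℕ) (γ : PreGallery n) : PreGallery n :=
  ⟨γ.len,
   fun i => if i ∈ L then sRefl α k '' γ.p i else γ.p i,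
   fun i => if i ∈ L then sRefl α k '' γ.c i else γ.c i⟩

/-- `P` is the index set of a single `H`-protrusion. -/
def IsFlipProtrusion (D : RootData n) (γ : PreGallery n) (α : V n) (k : ℝ) (P : Set ℕ) :
    Prop :=
  (∃ j m, IsProtrusionFin D γ α k j m ∧ P = Set.Ico j m) ∨
  (∃ j, IsProtrusionInf D γ α k j ∧ P = Set.Ici j)

/-- `P` is the index set of a single `H`-indentation. -/
def IsFlipIndentation (D : RootData n) (γ : PreGallery n) (α : V n) (k : ℝ) (P : Set ℕ) :
    Prop :=
  (∃ j m, IsIndentationFin D γ α k j m ∧ P = Set.Ico j m) ∨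
  (∃ j, IsIndentationInf D γ α k j ∧ P = Set.Ici j)

/-- `L` is an `H`-outcrop: a disjoint union of `H`-protrusions. -/
def IsOutcrop (D : RootData n) (γ : PreGallery n) (α : V n) (k : ℝ) (L : Set ℕ) : Prop :=
  ∃ C : Set (Set ℕ), (∀ P ∈ C, IsFlipProtrusion D γ α k P) ∧ C.Pairwise Disjoint ∧
    L = ⋃₀ C

/-- `L` is an `H`-ingrowth: a disjoint union of `H`-indentations. -/
def IsIngrowth (D : RootData n) (γ : PreGallery n) (α : V n) (k : ℝ) (L : Set ℕ) : Prop :=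
  ∃ C : Set (Set ℕ), (∀ P ∈ C, IsFlipIndentation D γ α k P) ∧ C.Pairwise Disjoint ∧
    L = ⋃₀ C

/-- The dominant Weyl chamber `C_f`. -/
def Cf (D : RootData n) : Set (V n) := {v | ∀ α ∈ D.pos, 0 ≤ ⟪α, v⟫}

/-- The closed half-space `α^{k,w}` bounded by `H_{α,k}` which contains a subsector of
the Weyl chamber `w·C_f`. -/
def halfFor (D : RootData n) (α : V n) (k : ℝ) (w : Equiv.Perm (V n)) : Set (V n) :=
  if ∀ v ∈ Cf D, 0 ≤ ⟪α, w v⟫ then Hge α k else Hle α k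

/-- The sub-root system `Φ_J` spanned by the simple roots indexed by `J`. -/
def PhiJ (D : RootData n) (J : Set (Fin n)) : Set (V n) :=
  {α | α ∈ D.Φ ∧ α ∈ Submodule.span ℝ (D.simple '' J)}

/-- The positive roots `Φ_J⁺` of the sub-root system `Φ_J`. -/
def PhiJpos (D : RootData n) (J : Set (Fin n)) : Set (V n) := D.pos ∩ PhiJ D J

/-- `w0` is the longest element of the finite Weyl group: it maps the dominant Weyl chamber
to the antidominant one. -/
def IsLongest (D : RootData n) (w0 : Equiv.Perm (V n)) : Prop :=
  w0 ∈ FinW D ∧ ⇑w0 '' Cf D = {v | -v ∈ Cf D}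

/-- The `J`-chimney `ξ_J`, a collection of closed half-spaces. -/
def chimney (D : RootData n) (J : Set (Fin n)) (w0 : Equiv.Perm (V n)) : Set (Set (V n)) :=
  {h | ∃ α ∈ PhiJpos D J, ∃ k : ℤ, k ≤ 0 ∧ h = halfFor D α (k : ℝ) 1} ∪
  {h | ∃ α ∈ PhiJpos D J, ∃ k : ℤ, 1 ≤ k ∧ h = halfFor D α (k : ℝ) w0} ∪
  {h | ∃ β ∈ D.pos \ PhiJpos D J, ∃ k : ℤ, h = halfFor D β (k : ℝ) w0}

/-- The `(J,y)`-chimney `ξ_{J,y} = y · ξ_J`. -/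
def chimneyY (D : RootData n) (J : Set (Fin n)) (w0 : Equiv.Perm (V n)) (y : AffW D) :
    Set (Set (V n)) :=
  {h | ∃ h' ∈ chimney D J w0, h = actW y h'}

/-- The orientation `φ_{J,y}` induced by the `(J,y)`-chimney: `φ(c,p) = +` iff the closed
half-space bounded by the supporting hyperplane of `p` which contains `c` is not an
element of `ξ_{J,y}`. -/
def chimneyOrient (D : RootData n) (J : Set (Fin n)) (w0 : Equiv.Perm (V n)) (y : AffW D) :
    Set (V n) → Set (V n) → Prop :=
  fun c p => ∀ α ∈ D.Φ, ∀ k : ℤ, p ⊆ Hy α (k : ℝ) →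
    ¬ ((c ⊆ Hge α (k : ℝ) ∧ Hge α (k : ℝ) ∈ chimneyY D J w0 y) ∨
       (c ⊆ Hle α (k : ℝ) ∧ Hle α (k : ℝ) ∈ chimneyY D J w0 y))

/-- The `J`-sector determined by integers `n_β`, `β ∈ Φ⁺ ∖ Φ_J⁺`. -/
def sectorJ (D : RootData n) (J : Set (Fin n)) (w0 : Equiv.Perm (V n)) (nb : V n → ℤ) :
    Set (V n) :=
  (⋂ α ∈ PhiJpos D J, halfFor D α 0 1 ∩ halfFor D α 1 w0) ∩
  ⋂ β ∈ D.pos \ PhiJpos D J, halfFor D β (nb β : ℝ) w0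

/-- The `(J,y)`-sector `y · S_J({n_β})`. -/
def sectorJY (D : RootData n) (J : Set (Fin n)) (w0 : Equiv.Perm (V n)) (y : AffW D)
    (nb : V n → ℤ) : Set (V n) :=
  actW y (sectorJ D J w0 nb)

/-- The data of an infinite combinatorial gallery `(p₀, c₀, p₁, c₁, …)`. -/
structure InfPreGallery (n : ℕ) where
  p : ℕ → Set (V n)
  c : ℕ → Set (V n)

/-- The gallery conditions for an infinite combinatorial gallery. -/
def IsInfGallery (D : RootData n) (Γ : InfPreGallery n) : Prop :=
  (∀ i, IsAlcove D (Γ.c i)) ∧ IsFace D (Γ.p 0) ∧ Γ.p 0 ⊆ Γ.c 0 ∧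
    ∀ i, 1 ≤ i → IsPanelOf D (Γ.p i) (Γ.c (i - 1)) ∧ IsPanelOf D (Γ.p i) (Γ.c i)

/-- The initial finite subgallery `(p₀, c₀, …, p_{m+1})` of an infinite gallery. -/
def truncGallery (Γ : InfPreGallery n) (m : ℕ) : PreGallery n := ⟨m, Γ.p, Γ.c⟩

/-- An infinite gallery is minimal if every initial finite subgallery is minimal. -/
def InfMinimal (D : RootData n) (Γ : InfPreGallery n) : Prop :=
  ∀ m : ℕ, IsMinimal D (truncGallery Γ m)

/-- Regularity of a (minimal infinite) gallery with respect to the `(J,y)`-sector, where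
`y = t^μ u`. -/
def RegularWrt (D : RootData n) (J : Set (Fin n)) (w0 u : Equiv.Perm (V n)) (μ : V n)
    (nb : V n → ℤ) (Γ : InfPreGallery n) : Prop :=
  ∀ β ∈ D.pos \ PhiJpos D J, ∀ k : ℤ,
    halfFor D (u β) (k : ℝ) (u * w0) ⊆
      halfFor D (u β) ((nb β : ℝ) + ⟪u β, μ⟫) (u * w0) →
    ∃ i, Γ.c i ⊆ halfFor D (u β) (k : ℝ) (u * w0)

/-- The panel of the fundamental alcove fixed by the generator `s ∈ S` (determining the
type of a panel). -/
def fixedPanelType {D : RootData n} (s : AffW D) : Set (V n) :=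
  fund D ∩ {v | (s : Equiv.Perm (V n)) v = v}

/-- `γ` has type `(type(σ0), s_{j₁}, …, s_{j_l}, type(τ))` where the `s_{jᵢ}` are the
entries of the word `l`. -/
def HasWordType (D : RootData n) (γ : PreGallery n) (σ0 : Set (V n)) (l : List (AffW D))
    (τ : Set (V n)) : Prop :=
  γ.len = l.length ∧ SameTypeFace D σ0 (γ.p 0) ∧ SameTypeFace D τ (γ.p (γ.len + 1)) ∧
    ∀ i, ∀ h : i < l.length, SameTypeFace D (fixedPanelType (l.get ⟨i, h⟩)) (γ.p (i + 1))

/-- `l` is a reduced word for `w ∈ W`. -/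
def IsReducedWord (D : RootData n) (l : List (AffW D)) (w : AffW D) : Prop :=
  (∀ s ∈ l, s ∈ SGen D) ∧ l.prod = w ∧ l.length = lenW D w

end

namespace ShadowRec

variable {n : ℕ}

lemma inner_self_ne {D : RootData n} {α : V n} (hα : α ∈ D.Φ) : (⟪α, α⟫ : ℝ) ≠ 0 := by
  have := D.nonzero α hα
  simpa using this

lemma sRefl_invol {α : V n} (h : (⟪α, α⟫ : ℝ) ≠ 0) (k : ℝ) (v : V n) :
    sRefl α k (sRefl α k v) = v := by
  have h2 : (⟪α, coroot α⟫ : ℝ) = 2 := by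
    simp only [coroot, inner_smul_right]; field_simp
  simp only [sRefl, inner_sub_right, inner_smul_right, h2]
  module

/-- The reflection as a permutation. -/
noncomputable def rPerm (α : V n) (h : (⟪α, α⟫ : ℝ) ≠ 0) (k : ℝ) : Equiv.Perm (V n) :=
  ⟨sRefl α k, sRefl α k, sRefl_invol h k, sRefl_invol h k⟩

lemma sRefl_cont (α : V n) (k : ℝ) : Continuous (sRefl α k) := by
  unfold sRefl; fun_prop

/-- The reflection as a homeomorphism. -/
noncomputable def rHomeo (α : V n) (h : (⟪α, α⟫ : ℝ) ≠ 0) (k : ℝ) : V n ≃ₜ V n :=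
  ⟨rPerm α h k, sRefl_cont α k, sRefl_cont α k⟩

lemma rPerm_mem {D : RootData n} {α : V n} (hα : α ∈ D.Φ) (k : ℤ) :
    rPerm α (inner_self_ne hα) (k : ℝ) ∈ AffW D :=
  Subgroup.subset_closure ⟨α, hα, k, rfl⟩

lemma sRefl_fix {α : V n} {k : ℝ} {v : V n} (h : v ∈ Hy α k) : sRefl α k v = v := by
  have : (⟪α, v⟫ : ℝ) = k := h
  simp [sRefl, this]

lemma sRefl_fix_iff {α : V n} (h : (⟪α, α⟫ : ℝ) ≠ 0) {k : ℝ} {v : V n} :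
    sRefl α k v = v ↔ v ∈ Hy α k := by
  refine ⟨fun hv => ?_, sRefl_fix⟩
  have h2 : (⟪α, coroot α⟫ : ℝ) = 2 := by
    simp only [coroot, inner_smul_right]; field_simp
  have := congrArg (fun w => (⟪α, w⟫ : ℝ)) hv
  simp only [sRefl, inner_sub_right, inner_smul_right, h2] at this
  show (⟪α, v⟫ : ℝ) = k
  linarith

lemma sRefl_inner {α : V n} (h : (⟪α, α⟫ : ℝ) ≠ 0) (k : ℝ) (v : V n) :
    (⟪α, sRefl α k v⟫ : ℝ) - k = -(⟪α, v⟫ - k) := by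
  have h2 : (⟪α, coroot α⟫ : ℝ) = 2 := by
    simp only [coroot, inner_smul_right]; field_simp
  simp only [sRefl, inner_sub_right, inner_smul_right, h2]
  ring

/-- `w` pulls back `H_{β,m}` to `H_{β',m'}`. -/
def Pulls (D : RootData n) (w : V n → V n) : Prop :=
  ∀ β ∈ D.Φ, ∀ m : ℤ, ∃ β' ∈ D.Φ, ∃ m' : ℤ,
    (∀ v, (⟪β, w v⟫ : ℝ) - m = ⟪β', v⟫ - m') ∧
    ∀ v, w (sRefl β' m' v) = sRefl β m (w v)

lemma pulls_refl {D : RootData n} {α : V n} (hα : α ∈ D.Φ) (k : ℤ) :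
    Pulls D (sRefl α (k : ℝ)) := by
  intro β hβ m
  obtain ⟨c, hc⟩ := D.crystallographic α hα β hβ
  have hr := D.reflect_mem α hα β hβ
  rw [hc] at hr
  have ha := inner_self_ne hα
  have hb := inner_self_ne hβ
  have hab : 2 * (⟪α, β⟫ : ℝ) = c * ⟪α, α⟫ := by field_simp at hc; linarith
  have hba : (⟪β, α⟫ : ℝ) = ⟪α, β⟫ := real_inner_comm _ _
  have hbc : (⟪β, coroot α⟫ : ℝ) = c := by
    simp only [coroot, inner_smul_right, hba, ← hc]; ring
  have hself : (⟪β - (c : ℝ) • α, β - (c : ℝ) • α⟫ : ℝ) = ⟪β, β⟫ := by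
    simp only [inner_sub_left, inner_sub_right, inner_smul_left, inner_smul_right, hba, conj_trivial]
    linear_combination (-(c : ℝ)) * hab
  have h1 : ∀ v, (⟪β, sRefl α k v⟫ : ℝ) - m
      = ⟪β - (c : ℝ) • α, v⟫ - ((m - k * c : ℤ) : ℝ) := by
    intro v
    simp only [sRefl, inner_sub_right, inner_smul_right, hbc, inner_sub_left, inner_smul_left]
    push_cast
    simp
    ring
  refine ⟨_, hr, m - k * c, h1, fun v => ?_⟩
  have h3 : sRefl β (m : ℝ) (sRefl α k v) = sRefl α k v -
      (⟪β - (c : ℝ) • α, v⟫ - ((m - k * c : ℤ) : ℝ)) • coroot β := by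
    rw [← h1 v]; rfl
  rw [h3]
  have h4 : coroot (β - (c : ℝ) • α) = coroot β - (⟪α, coroot β⟫ : ℝ) • coroot α := by
    simp only [coroot, hself, inner_smul_right, smul_sub, smul_smul]
    congr 2
    field_simp
    linarith
  have h5 : (⟪α, coroot α⟫ : ℝ) = 2 := by
    simp only [coroot, inner_smul_right]; field_simp
  conv_lhs => rw [sRefl]
  rw [sRefl, sRefl]
  simp only [h4, inner_sub_right, inner_smul_right, h5]
  module

lemma pulls_W {D : RootData n} (w : Equiv.Perm (V n)) (hw : w ∈ AffW D) :
    Pulls D w := by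
  have hmul : ∀ a b : Equiv.Perm (V n), Pulls D a → Pulls D b → Pulls D (a * b : Equiv.Perm _) := by
    intro a b ha hb β hβ m
    obtain ⟨β1, h1, m1, e1, f1⟩ := ha β hβ m
    obtain ⟨β2, h2, m2, e2, f2⟩ := hb β1 h1 m1
    refine ⟨β2, h2, m2, fun v => ?_, fun v => ?_⟩
    · rw [Equiv.Perm.mul_apply, e1, e2]
    · rw [Equiv.Perm.mul_apply, Equiv.Perm.mul_apply, f2, f1]
  induction hw using Subgroup.closure_induction_left with
  | one => exact fun β hβ m => ⟨β, hβ, m, fun v => rfl, fun v => rfl⟩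
  | mul_left x hx y hy ih =>
    refine hmul _ _ ?_ ih
    obtain ⟨α, hα, k, e⟩ := hx
    rw [e]; exact pulls_refl hα k
  | inv_mul_cancel x hx y hy ih =>
    refine hmul _ _ ?_ ih
    obtain ⟨α, hα, k, e⟩ := hx
    have : ⇑x⁻¹ = sRefl α k := by
      funext v
      rw [Equiv.Perm.inv_eq_iff_eq, e, sRefl_invol (inner_self_ne hα)]
    rw [this]; exact pulls_refl hα k

/-! ### The fundamental alcove -/

lemma exists_dual (D : RootData n) (f : Fin n → ℝ) : ∃ v : V n, ∀ j, (⟪D.simple j, v⟫ : ℝ) = f j := by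
  let F : V n →ₗ[ℝ] (Fin n → ℝ) := LinearMap.pi fun j => (innerₛₗ ℝ (D.simple j))
  have hF : ∀ v j, F v j = ⟪D.simple j, v⟫ := fun v j => rfl
  have hspan : Submodule.span ℝ (Set.range D.simple) = ⊤ :=
    D.simple_indep.span_eq_top_of_card_eq_finrank' (by simp)
  have hinj : Function.Injective F := by
    rw [← LinearMap.ker_eq_bot, LinearMap.ker_eq_bot']
    intro v hv
    have h0 : ∀ w ∈ Submodule.span ℝ (Set.range D.simple), (⟪w, v⟫ : ℝ) = 0 := by
      intro w hw
      induction hw using Submodule.span_induction with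
      | mem x hx =>
        obtain ⟨j, rfl⟩ := hx
        rw [← hF, hv]; rfl
      | zero => simp
      | add x y _ _ hx hy => rw [inner_add_left, hx, hy, add_zero]
      | smul a x _ hx => rw [inner_smul_left, hx, mul_zero]
    have := h0 v (hspan ▸ Submodule.mem_top)
    simpa using this
  have hsurj := (LinearMap.injective_iff_surjective_of_finrank_eq_finrank (by simp)).1 hinj
  obtain ⟨v, hv⟩ := hsurj f
  exact ⟨v, fun j => by rw [← hF, hv]⟩

lemma small_t (D : RootData n) (v u : V n)
    (h1 : ∀ j, 0 < (⟪D.simple j, v⟫ : ℝ) ∨ (⟪D.simple j, v⟫ = (0 : ℝ) ∧ ⟪D.simple j, u⟫ = (0 : ℝ)))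
    (h2 : (⟪D.highest, v⟫ : ℝ) < 1 ∨ (⟪D.highest, v⟫ = (1 : ℝ) ∧ ⟪D.highest, u⟫ = (0 : ℝ))) :
    ∃ t : ℝ, 0 < t ∧ v + t • u ∈ fund D := by
  have e1 : ∀ j, ∀ᶠ t : ℝ in nhdsWithin 0 (Set.Ioi 0), 0 ≤ (⟪D.simple j, v + t • u⟫ : ℝ) := by
    intro j
    rcases h1 j with h | ⟨h, h'⟩
    · apply nhdsWithin_le_nhds
      have hc : Continuous fun t : ℝ => (⟪D.simple j, v + t • u⟫ : ℝ) := by fun_prop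
      have := hc.continuousAt (x := 0) |>.eventually (lt_mem_nhds (by simpa using h))
      exact this.mono fun t ht => ht.le
    · refine Filter.Eventually.of_forall fun t => ?_
      simp [inner_add_right, inner_smul_right, h, h']
  have e2 : ∀ᶠ t : ℝ in nhdsWithin 0 (Set.Ioi 0), (⟪D.highest, v + t • u⟫ : ℝ) ≤ 1 := by
    rcases h2 with h | ⟨h, h'⟩
    · apply nhdsWithin_le_nhds
      have hc : Continuous fun t : ℝ => (⟪D.highest, v + t • u⟫ : ℝ) := by fun_prop
      have := hc.continuousAt (x := 0) |>.eventually (gt_mem_nhds (by simpa using h))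
      exact this.mono fun t ht => ht.le
    · refine Filter.Eventually.of_forall fun t => ?_
      simp [inner_add_right, inner_smul_right, h, h']
  have e3 : ∀ᶠ t : ℝ in nhdsWithin 0 (Set.Ioi 0), 0 < t := self_mem_nhdsWithin
  obtain ⟨t, ht⟩ := ((Filter.eventually_all.2 e1).and (e2.and e3)).exists
  exact ⟨t, ht.2.2, ht.1, ht.2.1⟩

lemma highest_sum (D : RootData n) : ∃ c : Fin n → ℝ, (∀ i, 0 ≤ c i) ∧ 0 < ∑ i, c i ∧
    ∀ v, (⟪D.highest, v⟫ : ℝ) = ∑ i, c i * ⟪D.simple i, v⟫ := by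
  obtain ⟨c, hc, e⟩ := D.pos_combo _ D.highest_mem
  refine ⟨c, hc, ?_, fun v => ?_⟩
  · refine lt_of_le_of_ne (Finset.sum_nonneg fun i _ => hc i) fun h => ?_
    have h0 := (Finset.sum_eq_zero_iff_of_nonneg fun i _ => hc i).1 h.symm
    apply D.nonzero _ (D.pos_sub D.highest_mem)
    rw [e]
    exact Finset.sum_eq_zero fun i hi => by rw [h0 i hi, zero_smul]
  · conv_lhs => rw [e]
    simp [sum_inner, inner_smul_left]

lemma facet_pt (D : RootData n) {s : AffW D} (hs : s ∈ SGen D) :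
    ∃ δ ∈ D.Φ, ∃ d : ℤ, ⇑(s : Equiv.Perm (V n)) = sRefl δ d ∧ ∃ v0 : V n, (⟪δ, v0⟫ : ℝ) = d ∧
      ∀ u, (⟪δ, u⟫ : ℝ) = 0 → ∃ t : ℝ, 0 < t ∧ v0 + t • u ∈ fund D := by
  obtain ⟨c, hc, hpos, hsum⟩ := highest_sum D
  rcases hs with hs | ⟨i, hs⟩
  · refine ⟨D.highest, D.pos_sub D.highest_mem, 1, by simpa using hs, ?_⟩
    obtain ⟨v, hv⟩ := exists_dual D fun _ => (∑ i, c i)⁻¹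
    have hv1 : (⟪D.highest, v⟫ : ℝ) = 1 := by
      rw [hsum]; simp only [hv]; rw [← Finset.sum_mul]; field_simp
    refine ⟨v, by simpa using hv1, fun u hu => small_t D v u (fun j => Or.inl ?_) (Or.inr ⟨hv1, hu⟩)⟩
    rw [hv]; positivity
  · refine ⟨D.simple i, D.pos_sub (D.simple_mem i), 0, by simpa using hs, ?_⟩
    obtain ⟨v, hv⟩ := exists_dual D fun j => if j = i then 0 else (2 * ∑ i, c i)⁻¹
    refine ⟨v, by simp [hv], fun u hu => small_t D v u (fun j => ?_) (Or.inl ?_)⟩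
    · by_cases h : j = i
      · subst h; right; exact ⟨by simp [hv], hu⟩
      · left; rw [hv, if_neg h]; positivity
    · rw [hsum]
      calc ∑ j, c j * (⟪D.simple j, v⟫ : ℝ) ≤ ∑ j, c j * (2 * ∑ i, c i)⁻¹ := by
            refine Finset.sum_le_sum fun j _ => mul_le_mul_of_nonneg_left ?_ (hc j)
            rw [hv]; split_ifs
            · positivity
            · exact le_rfl
        _ = 1 / 2 := by rw [← Finset.sum_mul]; field_simp
        _ < 1 := by norm_num

lemma fund_not_sub (D : RootData n) {β : V n} (hβ : β ∈ D.Φ) (m : ℝ) : ¬ fund D ⊆ Hy β m := by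
  intro h
  obtain ⟨c, hc, hpos, hsum⟩ := highest_sum D
  obtain ⟨v, hv⟩ := exists_dual D fun _ => (2 * ∑ i, c i)⁻¹
  have key : ∀ u, ∃ t : ℝ, 0 < t ∧ v + t • u ∈ fund D := by
    intro u
    refine small_t D v u (fun j => Or.inl (by rw [hv]; positivity)) (Or.inl ?_)
    rw [hsum]; simp only [hv]; rw [← Finset.sum_mul]; field_simp; norm_num
  obtain ⟨t0, _, h0⟩ := key 0
  obtain ⟨t1, ht1, h1⟩ := key β
  have a0 : (⟪β, _⟫ : ℝ) = m := h h0
  have a1 : (⟪β, _⟫ : ℝ) = m := h h1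
  simp only [inner_add_right, inner_smul_right, inner_zero_right] at a0 a1
  have : t1 * (⟪β, β⟫ : ℝ) = 0 := by linarith
  rcases mul_eq_zero.1 this with h | h
  · exact ht1.ne' h
  · exact inner_self_ne hβ h

lemma fund_side_pos (D : RootData n) {β : V n} (hβ : β ∈ D.pos) (m : ℤ) :
    fund D ⊆ Hge β m ∨ fund D ⊆ Hle β m := by
  have h01 : ∀ v ∈ fund D, 0 ≤ (⟪β, v⟫ : ℝ) ∧ (⟪β, v⟫ : ℝ) ≤ 1 := by
    intro v hv
    have hnn : ∀ (c : Fin n → ℝ), (∀ i, 0 ≤ c i) → 0 ≤ (⟪∑ i, c i • D.simple i, v⟫ : ℝ) := by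
      intro c hc
      simp only [sum_inner, inner_smul_left]
      exact Finset.sum_nonneg fun i _ => mul_nonneg (hc i) (hv.1 i)
    obtain ⟨c, hc, e⟩ := D.pos_combo β hβ
    obtain ⟨c', hc', e'⟩ := D.highest_dominates β hβ
    have h1 := hnn c hc
    have h2 := hnn c' hc'
    rw [← e] at h1
    rw [← e', inner_sub_left] at h2
    exact ⟨h1, by linarith [hv.2]⟩
  rcases le_or_gt m 0 with h | h
  · left; intro v hv
    have : (m : ℝ) ≤ 0 := by exact_mod_cast h
    exact this.trans (h01 v hv).1
  · right; intro v hv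
    have : (1 : ℝ) ≤ m := by exact_mod_cast h
    exact (h01 v hv).2.trans this

lemma Hge_neg (β : V n) (m : ℝ) : Hge (-β) (-m) = Hle β m := by
  ext v; simp [Hge, Hle, inner_neg_left]

lemma Hle_neg (β : V n) (m : ℝ) : Hle (-β) (-m) = Hge β m := by
  ext v; simp [Hge, Hle, inner_neg_left]

lemma fund_side (D : RootData n) {β : V n} (hβ : β ∈ D.Φ) (m : ℤ) :
    fund D ⊆ Hge β m ∨ fund D ⊆ Hle β m := by
  rcases D.pos_total β hβ with h | h
  · exact fund_side_pos D h m
  · have := fund_side_pos D h (-m)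
    push_cast at this
    rw [Hge_neg, Hle_neg] at this
    exact this.symm

/-! ### Uniqueness of the separating wall -/

lemma sep_unique0 (D : RootData n) {s : AffW D} (hs : s ∈ SGen D) {β : V n} (hβ : β ∈ D.Φ) (m : ℤ)
    (h : Separates β (m : ℝ) (fund D) (actW s (fund D))) :
    ⇑(s : Equiv.Perm (V n)) = sRefl β m := by
  obtain ⟨δ, hδ, d, e, v0, hv0, hf⟩ := facet_pt D hs
  have key : ∀ u, (⟪δ, u⟫ : ℝ) = 0 → ∃ t : ℝ, 0 < t ∧ (⟪β, v0 + t • u⟫ : ℝ) = m := by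
    intro u hu
    obtain ⟨t, ht, hm⟩ := hf u hu
    have hfix : v0 + t • u ∈ actW s (fund D) := by
      refine ⟨_, hm, ?_⟩
      rw [e]; apply sRefl_fix
      show (⟪δ, _⟫ : ℝ) = d
      rw [inner_add_right, inner_smul_right, hu, hv0]; ring
    refine ⟨t, ht, ?_⟩
    rcases h with ⟨h1, h2⟩ | ⟨h1, h2⟩
    · exact le_antisymm (h2 hfix) (h1 hm)
    · exact le_antisymm (h1 hm) (h2 hfix)
  have hv : (⟪β, v0⟫ : ℝ) = m := by
    obtain ⟨t, _, h⟩ := key 0 (by simp)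
    simpa using h
  have hd := inner_self_ne hδ
  have hb := inner_self_ne hβ
  set c : ℝ := ⟪δ, β⟫ / ⟪δ, δ⟫ with hc
  have hu : (⟪δ, β - c • δ⟫ : ℝ) = 0 := by
    rw [inner_sub_right, inner_smul_right, hc]; field_simp; ring
  obtain ⟨t, ht, h2⟩ := key _ hu
  rw [inner_add_right, inner_smul_right, hv] at h2
  have h3 : (⟪β, β - c • δ⟫ : ℝ) = 0 := by
    have : t * (⟪β, β - c • δ⟫ : ℝ) = 0 := by linarith
    exact (mul_eq_zero.1 this).resolve_left ht.ne'
  have h4 : (⟪β - c • δ, β - c • δ⟫ : ℝ) = 0 := by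
    conv_lhs => rw [inner_sub_left, inner_smul_left, hu, h3]
    simp
  have h5 : β = c • δ := sub_eq_zero.1 (inner_self_eq_zero.1 h4)
  have hc0 : c ≠ 0 := by
    rintro h0; rw [h0, zero_smul] at h5; exact D.nonzero _ hβ h5
  have hm : (m : ℝ) = c * d := by
    rw [← hv, h5, inner_smul_left, hv0]; rfl
  rw [e]
  funext v
  rw [h5, hm]
  clear_value c
  simp only [sRefl, coroot, inner_smul_left, inner_smul_right, smul_smul]
  congr 2
  simp
  field_simp

lemma actW_mul {D : RootData n} (x y : AffW D) (A : Set (V n)) :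
    actW (x * y) A = actW x (actW y A) := by
  simp only [actW, Set.image_image]; rfl

lemma actW_sub_Hge {D : RootData n} (x : AffW D) {β β' : V n} {m m' : ℤ}
    (h : ∀ v, (⟪β, (x : Equiv.Perm (V n)) v⟫ : ℝ) - m = ⟪β', v⟫ - m') (A : Set (V n)) :
    actW x A ⊆ Hge β m ↔ A ⊆ Hge β' m' := by
  simp only [actW, Set.image_subset_iff]
  refine forall_congr' fun v => forall_congr' fun _ => ?_
  have := h v
  show (m : ℝ) ≤ ⟪β, _⟫ ↔ (m' : ℝ) ≤ ⟪β', v⟫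
  constructor <;> intro <;> linarith

lemma actW_sub_Hle {D : RootData n} (x : AffW D) {β β' : V n} {m m' : ℤ}
    (h : ∀ v, (⟪β, (x : Equiv.Perm (V n)) v⟫ : ℝ) - m = ⟪β', v⟫ - m') (A : Set (V n)) :
    actW x A ⊆ Hle β m ↔ A ⊆ Hle β' m' := by
  simp only [actW, Set.image_subset_iff]
  refine forall_congr' fun v => forall_congr' fun _ => ?_
  have := h v
  show ⟪β, _⟫ ≤ (m : ℝ) ↔ ⟪β', v⟫ ≤ (m' : ℝ)
  constructor <;> intro <;> linarith

lemma sep_unique (D : RootData n) (y : AffW D) {s : AffW D} (hs : s ∈ SGen D) {β : V n}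
    (hβ : β ∈ D.Φ) (m : ℤ)
    (h : Separates β (m : ℝ) (actW y (fund D)) (actW (y * s) (fund D))) :
    ∀ v, (y * s : AffW D).1 v = sRefl β m (y.1 v) := by
  obtain ⟨β', hβ', m', e, f⟩ := pulls_W y.1 y.2 β hβ m
  have h' : Separates β' (m' : ℝ) (fund D) (actW s (fund D)) := by
    rw [actW_mul] at h
    simpa only [Separates, actW_sub_Hge y e, actW_sub_Hle y e] using h
  have := sep_unique0 D hs hβ' m' h'
  intro v
  rw [← f, ← this]; rfl

lemma actW_side (D : RootData n) (y : AffW D) {β : V n} (hβ : β ∈ D.Φ) (m : ℤ) :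
    actW y (fund D) ⊆ Hge β m ∨ actW y (fund D) ⊆ Hle β m := by
  obtain ⟨β', hβ', m', e, f⟩ := pulls_W y.1 y.2 β hβ m
  rw [actW_sub_Hge y e, actW_sub_Hle y e]
  exact fund_side D hβ' m'

lemma actW_not_both (D : RootData n) (y : AffW D) {β : V n} (hβ : β ∈ D.Φ) (m : ℤ)
    (h1 : actW y (fund D) ⊆ Hge β m) (h2 : actW y (fund D) ⊆ Hle β m) : False := by
  obtain ⟨β', hβ', m', e, f⟩ := pulls_W y.1 y.2 β hβ m
  rw [actW_sub_Hge y e] at h1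
  rw [actW_sub_Hle y e] at h2
  exact fund_not_sub D hβ' m' fun v hv => le_antisymm (h2 hv) (h1 hv)

/-! ### The length condition -/

lemma SGen_sq {D : RootData n} {s : AffW D} (hs : s ∈ SGen D) : s * s = 1 := by
  obtain ⟨δ, hδ, d, e, -⟩ := facet_pt D hs
  apply Subtype.ext
  ext1 v
  show s.1 (s.1 v) = v
  rw [e, sRefl_invol (inner_self_ne hδ)]

lemma actW_one {D : RootData n} (A : Set (V n)) : actW (1 : AffW D) A = A := by
  simp [actW]

lemma exchange (D : RootData n) (l : List (AffW D)) (hl : ∀ s ∈ l, s ∈ SGen D) :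
    ∀ {β : V n}, β ∈ D.Φ → ∀ m : ℤ, fund D ⊆ Hge β m → actW l.prod (fund D) ⊆ Hle β m →
    ∃ l' : List (AffW D), (∀ s ∈ l', s ∈ SGen D) ∧ l'.length < l.length ∧
      ∀ v, l'.prod.1 v = sRefl β m (l.prod.1 v) := by
  induction l with
  | nil =>
    intro β hβ m h1 h2
    rw [List.prod_nil, actW_one] at h2
    exact (fund_not_sub D hβ m fun v hv => le_antisymm (h2 hv) (h1 hv)).elim
  | cons s t ih =>
    intro β hβ m h1 h2
    have hs : s ∈ SGen D := hl s (by simp)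
    have ht : ∀ s ∈ t, s ∈ SGen D := fun a ha => hl a (by simp [ha])
    rw [List.prod_cons] at h2 ⊢
    rcases actW_side D s hβ m with h | h
    · obtain ⟨β', hβ', m', e, f⟩ := pulls_W s.1 s.2 β hβ m
      rw [actW_sub_Hge s e] at h
      rw [actW_mul, actW_sub_Hle s e] at h2
      obtain ⟨l', a, b, c⟩ := ih ht hβ' m' h h2
      refine ⟨s :: l', ?_, by simpa using b, fun v => ?_⟩
      · intro x hx
        rcases List.mem_cons.1 hx with rfl | hx
        · exact hs
        · exact a x hx
      · rw [List.prod_cons]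
        show s.1 (l'.prod.1 v) = sRefl β m (s.1 (t.prod.1 v))
        rw [c, f]
    · have := sep_unique0 D hs hβ m (Or.inl ⟨h1, h⟩)
      refine ⟨t, ht, by simp, fun v => ?_⟩
      show t.prod.1 v = sRefl β m (s.1 (t.prod.1 v))
      rw [this, sRefl_invol (inner_self_ne hβ)]

lemma fund_Hle (D : RootData n) (y s : AffW D) (hs : s ∈ SGen D)
    (hlen : lenW D y < lenW D (y * s)) {α : V n} (hα : α ∈ D.Φ) (k : ℤ)
    (hA : actW y (fund D) ⊆ Hle α k) (hB : actW (y * s) (fund D) ⊆ Hge α k) :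
    fund D ⊆ Hle α k := by
  rcases fund_side D hα k with h | h
  swap
  · exact h
  exfalso
  have hne : {m | ∃ l : List (AffW D), (∀ s ∈ l, s ∈ SGen D) ∧ l.length = m ∧
      l.prod = y * s}.Nonempty := by
    by_contra hcon
    rw [Set.not_nonempty_iff_eq_empty] at hcon
    rw [lenW, lenW, hcon, Nat.sInf_empty] at hlen
    omega
  obtain ⟨m, l, hl, -, hp⟩ := hne
  have hne' : {m | ∃ l : List (AffW D), (∀ s ∈ l, s ∈ SGen D) ∧ l.length = m ∧
      l.prod = y}.Nonempty := by
    refine ⟨_, l ++ [s], ?_, rfl, ?_⟩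
    · intro a ha
      rcases List.mem_append.1 ha with ha | ha
      · exact hl a ha
      · rw [List.mem_singleton.1 ha]; exact hs
    · rw [List.prod_append, hp, List.prod_singleton, mul_assoc, SGen_sq hs, mul_one]
  obtain ⟨l0, hl0, hlen0, hp0⟩ := Nat.sInf_mem hne'
  obtain ⟨l', a, b, c⟩ := exchange D l0 hl0 hα k h (by rw [hp0]; exact hA)
  have hys := sep_unique D y hs hα k (Or.inr ⟨hA, hB⟩)
  have : lenW D (y * s) ≤ l'.length := by
    apply Nat.sInf_le
    refine ⟨l', a, rfl, ?_⟩
    apply Subtype.ext; ext1 v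
    rw [c, hys, hp0]
  have h3 : l0.length = lenW D y := hlen0
  omega

/-! ### Transport of the complex under a reflection -/

section Transport

variable {D : RootData n} {α : V n}

lemma rr_image (hα : α ∈ D.Φ) (k : ℤ) (X : Set (V n)) :
    sRefl α (k : ℝ) '' (sRefl α (k : ℝ) '' X) = X := by
  rw [Set.image_image]
  simp only [sRefl_invol (inner_self_ne hα), Set.image_id']

lemma mem_r_image (hα : α ∈ D.Φ) (k : ℤ) (X : Set (V n)) (v : V n) :
    v ∈ sRefl α (k : ℝ) '' X ↔ sRefl α (k : ℝ) v ∈ X := by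
  constructor
  · rintro ⟨w, hw, rfl⟩
    rwa [sRefl_invol (inner_self_ne hα)]
  · intro h
    exact ⟨_, h, sRefl_invol (inner_self_ne hα) _ _⟩

lemma r_image_sub_iff (hα : α ∈ D.Φ) (k : ℤ) (X Y : Set (V n)) :
    sRefl α (k : ℝ) '' X ⊆ Y ↔ X ⊆ sRefl α (k : ℝ) '' Y := by
  rw [Set.image_subset_iff]
  refine forall_congr' fun v => forall_congr' fun _ => ?_
  exact (mem_r_image hα k Y v).symm

lemma r_image_fix {α : V n} {k : ℝ} {p : Set (V n)} (h : p ⊆ Hy α k) : sRefl α k '' p = p := by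
  ext v
  constructor
  · rintro ⟨w, hw, rfl⟩
    rwa [sRefl_fix (h hw)]
  · intro hv
    exact ⟨v, hv, sRefl_fix (h hv)⟩

lemma mem_wall_of (hα : α ∈ D.Φ) (k : ℤ) {v : V n}
    (h : sRefl α (k : ℝ) v ∈ wallUnion D) : v ∈ wallUnion D := by
  simp only [wallUnion, Set.mem_iUnion] at h ⊢
  obtain ⟨β, hβ, m, hm⟩ := h
  obtain ⟨β', hβ', m', e, -⟩ := pulls_refl hα k β hβ m
  refine ⟨β', hβ', m', ?_⟩
  have h1 : (⟪β, sRefl α (k : ℝ) v⟫ : ℝ) = m := hm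
  have := e v
  show (⟪β', v⟫ : ℝ) = m'
  linarith

lemma r_image_compl (hα : α ∈ D.Φ) (k : ℤ) :
    sRefl α (k : ℝ) '' (wallUnion D)ᶜ = (wallUnion D)ᶜ := by
  ext v
  rw [mem_r_image hα]
  constructor
  · intro h hv
    refine h (mem_wall_of hα k ?_)
    rwa [sRefl_invol (inner_self_ne hα)]
  · intro h hv
    exact h (mem_wall_of hα k hv)

lemma r_alcove (hα : α ∈ D.Φ) (k : ℤ) {c : Set (V n)} (hc : IsAlcove D c) :
    IsAlcove D (sRefl α (k : ℝ) '' c) := by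
  obtain ⟨v, hv, rfl⟩ := hc
  have h1 := (rHomeo α (inner_self_ne hα) (k : ℝ)).image_connectedComponentIn hv
  have h2 := (rHomeo α (inner_self_ne hα) (k : ℝ)).image_closure
    (connectedComponentIn (wallUnion D)ᶜ v)
  have e : ⇑(rHomeo α (inner_self_ne hα) (k : ℝ)) = sRefl α (k : ℝ) := rfl
  rw [e] at h1 h2
  rw [r_image_compl hα] at h1
  refine ⟨sRefl α (k : ℝ) v, ?_, ?_⟩
  · rw [← r_image_compl hα k]
    exact ⟨v, hv, rfl⟩
  · rw [h2, h1]

lemma r_face (hα : α ∈ D.Φ) (k : ℤ) {F : Set (V n)} (hF : IsFace D F) :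
    IsFace D (sRefl α (k : ℝ) '' F) := by
  obtain ⟨v, rfl⟩ := hF
  have key : ∀ w v : V n, (∀ β ∈ D.Φ, ∀ m : ℤ,
      (⟪β, w⟫ = (m : ℝ) ↔ ⟪β, v⟫ = (m : ℝ)) ∧ (⟪β, w⟫ < (m : ℝ) ↔ ⟪β, v⟫ < (m : ℝ))) →
      (∀ β ∈ D.Φ, ∀ m : ℤ,
      (⟪β, sRefl α (k : ℝ) w⟫ = (m : ℝ) ↔ ⟪β, sRefl α (k : ℝ) v⟫ = (m : ℝ)) ∧
      (⟪β, sRefl α (k : ℝ) w⟫ < (m : ℝ) ↔ ⟪β, sRefl α (k : ℝ) v⟫ < (m : ℝ))) := by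
    intro w v h β hβ m
    obtain ⟨β', hβ', m', e, -⟩ := pulls_refl hα k β hβ m
    have hw := e w
    have hv := e v
    obtain ⟨h1, h2⟩ := h β' hβ' m'
    refine ⟨?_, ?_⟩
    · rw [← sub_eq_zero, hw, sub_eq_zero, h1, ← sub_eq_zero, ← hv, sub_eq_zero]
    · rw [← sub_neg, hw, sub_neg, h2, ← sub_neg, ← hv, sub_neg]
  have h2 := (rHomeo α (inner_self_ne hα) (k : ℝ)).image_closure
    {w | ∀ α ∈ D.Φ, ∀ k : ℤ,
    (⟪α, w⟫ = (k : ℝ) ↔ ⟪α, v⟫ = (k : ℝ)) ∧ (⟪α, w⟫ < (k : ℝ) ↔ ⟪α, v⟫ < (k : ℝ))}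
  have e : ⇑(rHomeo α (inner_self_ne hα) (k : ℝ)) = sRefl α (k : ℝ) := rfl
  rw [e] at h2
  refine ⟨sRefl α (k : ℝ) v, ?_⟩
  rw [h2]
  congr 1
  ext w
  rw [mem_r_image hα]
  constructor
  · intro h
    have := key _ _ h
    rwa [sRefl_invol (inner_self_ne hα)] at this
  · intro h
    have := key _ _ h
    rwa [sRefl_invol (inner_self_ne hα)] at this

lemma r_hyper (hα : α ∈ D.Φ) (k : ℤ) {H : Set (V n)} (hH : H ∈ hyperplanes D) :
    sRefl α (k : ℝ) '' H ∈ hyperplanes D := by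
  obtain ⟨β, hβ, m, rfl⟩ := hH
  obtain ⟨β', hβ', m', e, -⟩ := pulls_refl hα k β hβ m
  refine ⟨β', hβ', m', ?_⟩
  ext v
  rw [mem_r_image hα]
  have := e v
  show (⟪β, _⟫ : ℝ) = m ↔ (⟪β', v⟫ : ℝ) = m'
  rw [← sub_eq_zero, this, sub_eq_zero]

lemma r_panel (hα : α ∈ D.Φ) (k : ℤ) {p c : Set (V n)} (h : IsPanelOf D p c) :
    IsPanelOf D (sRefl α (k : ℝ) '' p) (sRefl α (k : ℝ) '' c) := by
  obtain ⟨h1, h2, ⟨H, hH, e⟩, H0, ⟨hH0, hp⟩, huniq⟩ := h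
  refine ⟨r_alcove hα k h1, r_face hα k h2, ⟨_, r_hyper hα k hH, ?_⟩, _,
    ⟨r_hyper hα k hH0, Set.image_mono hp⟩, ?_⟩
  · rw [e, Set.image_inter]
    exact (rPerm α (inner_self_ne hα) (k : ℝ)).injective
  · rintro H' ⟨hH', hp'⟩
    rw [r_image_sub_iff hα] at hp'
    have := huniq _ ⟨r_hyper hα k hH', hp'⟩
    rw [← this, rr_image hα]

lemma r_orient (hα : α ∈ D.Φ) (k : ℤ) {A c p : Set (V n)} (h : alcoveOrient D A c p) :
    alcoveOrient D (sRefl α (k : ℝ) '' A) (sRefl α (k : ℝ) '' c) (sRefl α (k : ℝ) '' p) := by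
  intro β hβ m hp hs
  obtain ⟨β', hβ', m', e, -⟩ := pulls_refl hα k β hβ m
  have e1 : ∀ X, sRefl α (k : ℝ) '' X ⊆ Hge β m ↔ X ⊆ Hge β' m' :=
    actW_sub_Hge (⟨rPerm α (inner_self_ne hα) (k : ℝ), rPerm_mem hα k⟩ : AffW D) e
  have e2 : ∀ X, sRefl α (k : ℝ) '' X ⊆ Hle β m ↔ X ⊆ Hle β' m' :=
    actW_sub_Hle (⟨rPerm α (inner_self_ne hα) (k : ℝ), rPerm_mem hα k⟩ : AffW D) e
  refine h β' hβ' m' ?_ ?_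
  · intro v hv
    have h1 : (⟪β, sRefl α (k : ℝ) v⟫ : ℝ) = m := hp ⟨v, hv, rfl⟩
    have := e v
    show (⟪β', v⟫ : ℝ) = m'
    linarith
  · simpa only [sameSide, e1, e2] using hs

lemma r_Hge (hα : α ∈ D.Φ) (k : ℤ) {X : Set (V n)} (h : X ⊆ Hge α k) :
    sRefl α (k : ℝ) '' X ⊆ Hle α k := by
  rintro _ ⟨v, hv, rfl⟩
  have h1 : (k : ℝ) ≤ ⟪α, v⟫ := h hv
  have := sRefl_inner (inner_self_ne hα) k v
  show (⟪α, _⟫ : ℝ) ≤ k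
  linarith

lemma r_Hle (hα : α ∈ D.Φ) (k : ℤ) {X : Set (V n)} (h : X ⊆ Hle α k) :
    sRefl α (k : ℝ) '' X ⊆ Hge α k := by
  rintro _ ⟨v, hv, rfl⟩
  have h1 : ⟪α, v⟫ ≤ (k : ℝ) := h hv
  have := sRefl_inner (inner_self_ne hα) k v
  show (k : ℝ) ≤ ⟪α, _⟫
  linarith

lemma alcove_side (hα : α ∈ D.Φ) (k : ℤ) {c : Set (V n)} (hc : IsAlcove D c) :
    c ⊆ Hge α k ∨ c ⊆ Hle α k := by
  obtain ⟨v, hv, rfl⟩ := hc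
  have hcont : Continuous fun w : V n => (⟪α, w⟫ : ℝ) := by fun_prop
  have hpre : IsPreconnected (connectedComponentIn (wallUnion D)ᶜ v) :=
    isPreconnected_connectedComponentIn
  have hne : ∀ w ∈ connectedComponentIn (wallUnion D)ᶜ v, (⟪α, w⟫ : ℝ) ≠ k := by
    intro w hw h
    apply connectedComponentIn_subset _ _ hw
    simp only [wallUnion, Set.mem_iUnion]
    exact ⟨α, hα, k, h⟩
  have hge : IsClosed (Hge α (k : ℝ)) := isClosed_le continuous_const hcont
  have hle : IsClosed (Hle α (k : ℝ)) := isClosed_le hcont continuous_const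
  rw [hge.closure_subset_iff, hle.closure_subset_iff]
  by_contra hcon
  push Not at hcon
  obtain ⟨h1, h2⟩ := hcon
  obtain ⟨a, ha, ha'⟩ := Set.not_subset.1 h1
  obtain ⟨b, hb, hb'⟩ := Set.not_subset.1 h2
  have ha2 : (⟪α, a⟫ : ℝ) < k := not_le.1 ha'
  have hb2 : (k : ℝ) < ⟪α, b⟫ := not_le.1 hb'
  obtain ⟨w, hw, hwk⟩ := hpre.intermediate_value ha hb hcont.continuousOn ⟨ha2.le, hb2.le⟩
  exact hne w hw hwk

lemma alcove_not_sub (hα : α ∈ D.Φ) (k : ℤ) {c : Set (V n)} (hc : IsAlcove D c) :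
    ¬ c ⊆ Hy α k := by
  obtain ⟨v, hv, rfl⟩ := hc
  intro h
  apply hv
  simp only [wallUnion, Set.mem_iUnion]
  exact ⟨α, hα, k, h (subset_closure (mem_connectedComponentIn hv))⟩

lemma sub_Hy {α : V n} {k : ℝ} {X : Set (V n)} (h1 : X ⊆ Hge α k) (h2 : X ⊆ Hle α k) :
    X ⊆ Hy α k := fun v hv => le_antisymm (h2 hv) (h1 hv)

lemma sameSide_of_hy_eq (hα : α ∈ D.Φ) {k : ℝ} {β : V n} (hβ : β ∈ D.Φ) {m : ℝ}
    (h : Hy α k = Hy β m) {X Y : Set (V n)} (hs : sameSide β m X Y) : sameSide α k X Y := by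
  have ha := inner_self_ne hα
  have hsub : ∀ v, (⟪α, v⟫ : ℝ) = k → (⟪β, v⟫ : ℝ) = m := fun v hv => by
    have : v ∈ Hy α k := hv
    rw [h] at this; exact this
  set c : ℝ := ⟪α, β⟫ / ⟪α, α⟫ with hc
  have hu : (⟪α, β - c • α⟫ : ℝ) = 0 := by
    rw [inner_sub_right, inner_smul_right, hc]; field_simp; ring
  have h1 := hsub ((k / ⟪α, α⟫) • α) (by rw [inner_smul_right]; field_simp)
  have h2 := hsub ((k / ⟪α, α⟫) • α + (β - c • α))
    (by rw [inner_add_right, inner_smul_right, hu]; field_simp; ring)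
  rw [inner_add_right, h1] at h2
  have h3 : (⟪β, β - c • α⟫ : ℝ) = 0 := by linarith
  have h4 : (⟪β - c • α, β - c • α⟫ : ℝ) = 0 := by
    conv_lhs => rw [inner_sub_left, inner_smul_left, hu, h3]
    simp
  have h5 : β = c • α := sub_eq_zero.1 (inner_self_eq_zero.1 h4)
  have hc0 : c ≠ 0 := by
    rintro h0; rw [h0, zero_smul] at h5; exact D.nonzero _ hβ h5
  clear_value c
  have hm : m = c * k := by
    rw [← h1, h5, inner_smul_right, inner_smul_left, conj_trivial]; field_simp
  have hin : ∀ v, (⟪β, v⟫ : ℝ) = c * ⟪α, v⟫ := fun v => by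
    rw [h5, inner_smul_left, conj_trivial]
  rcases lt_or_gt_of_ne hc0 with hneg | hpos
  · have g1 : Hge β m = Hle α k := by
      ext v; simp only [Hge, Hle, Set.mem_setOf_eq, hin, hm]
      exact mul_le_mul_left_of_neg hneg
    have g2 : Hle β m = Hge α k := by
      ext v; simp only [Hge, Hle, Set.mem_setOf_eq, hin, hm]
      exact mul_le_mul_left_of_neg hneg
    rw [sameSide, g1, g2] at hs
    exact hs.symm
  · have g1 : Hge β m = Hge α k := by
      ext v; simp only [Hge, Set.mem_setOf_eq, hin, hm]
      exact mul_le_mul_iff_right₀ hpos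
    have g2 : Hle β m = Hle α k := by
      ext v; simp only [Hle, Set.mem_setOf_eq, hin, hm]
      exact mul_le_mul_iff_right₀ hpos
    rw [sameSide, g1, g2] at hs
    exact hs

lemma orient_wall (hα : α ∈ D.Φ) (k : ℤ) {B c p : Set (V n)} (hp : IsPanelOf D p c)
    (hpH : p ⊆ Hy α k) (hB : ¬ B ⊆ Hy α k) (hs : Separates α (k : ℝ) c B) :
    alcoveOrient D B c p := by
  intro β hβ m hpm hsame
  have heq : Hy α (k : ℝ) = Hy β (m : ℝ) :=
    hp.2.2.2.unique ⟨⟨α, hα, k, rfl⟩, hpH⟩ ⟨⟨β, hβ, m, rfl⟩, hpm⟩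
  have hsame' := sameSide_of_hy_eq hα hβ heq hsame
  have hc := alcove_not_sub hα k hp.1
  rcases hs with ⟨h1, h2⟩ | ⟨h1, h2⟩ <;> rcases hsame' with ⟨h3, h4⟩ | ⟨h3, h4⟩
  · exact hB (sub_Hy h4 h2)
  · exact hc (sub_Hy h1 h3)
  · exact hc (sub_Hy h3 h1)
  · exact hB (sub_Hy h2 h4)

/-! ### Flipping galleries -/

lemma same_type_flip (hα : α ∈ D.Φ) (k : ℤ) {L : Set ℕ} {γ0 γ : PreGallery n}
    (h : SameTypeGallery D γ0 γ) : SameTypeGallery D γ0 (flipGallery α (k : ℝ) L γ) := by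
  refine ⟨h.1, fun i hi => ?_⟩
  obtain ⟨x, hx, e⟩ := h.2 i hi
  by_cases hL : i ∈ L
  · refine ⟨rPerm α (inner_self_ne hα) (k : ℝ) * x, mul_mem (rPerm_mem hα k) hx, ?_⟩
    simp only [flipGallery, if_pos hL, e, Set.image_image]
    rfl
  · refine ⟨x, hx, ?_⟩
    simp only [flipGallery, if_neg hL, e]

lemma flip_p {k : ℤ} {L : Set ℕ} {γ : PreGallery n} {i j : ℕ}
    (h : γ.p i ⊆ Hy α k ∨ (j ∈ L ↔ i ∈ L)) :
    (flipGallery α (k : ℝ) L γ).p i = if j ∈ L then sRefl α (k : ℝ) '' γ.p i else γ.p i := by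
  rcases h with h | h
  · have := r_image_fix h
    simp only [flipGallery, this, ite_self]
  · simp only [flipGallery, h]

lemma flip_gallery (hα : α ∈ D.Φ) (k : ℤ) {L : Set ℕ} {γ : PreGallery n} (hγ : IsGallery D γ)
    (hL : ∀ i, 1 ≤ i → i ≤ γ.len + 1 → γ.p i ⊆ Hy α k ∨ (i - 1 ∈ L ↔ i ∈ L)) :
    IsGallery D (flipGallery α (k : ℝ) L γ) := by
  obtain ⟨h1, ⟨h2, h2'⟩, ⟨h3, h3'⟩, h4⟩ := hγ
  have hface : ∀ i, IsFace D (γ.p i) → IsFace D ((flipGallery α (k : ℝ) L γ).p i) := by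
    intro i hi
    simp only [flipGallery]
    split_ifs
    · exact r_face hα k hi
    · exact hi
  refine ⟨fun i hi => ?_, ⟨hface _ h2, ?_⟩, ⟨hface _ h3, ?_⟩, fun i hi hi' => ?_⟩
  · simp only [flipGallery]
    split_ifs
    · exact r_alcove hα k (h1 i hi)
    · exact h1 i hi
  · simp only [flipGallery]
    split_ifs
    · exact Set.image_mono h2'
    · exact h2'
  · have := flip_p (hL (γ.len + 1) (by omega) le_rfl)
    show (flipGallery α (k : ℝ) L γ).p (γ.len + 1) ⊆ _
    rw [this]
    simp only [flipGallery, Nat.add_sub_cancel]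
    split_ifs
    · exact Set.image_mono h3'
    · exact h3'
  · obtain ⟨g1, g2⟩ := h4 i hi hi'
    constructor
    · rw [flip_p (hL i hi (le_trans hi' (Nat.le_succ _)))]
      simp only [flipGallery]
      split_ifs
      · exact r_panel hα k g1
      · exact g1
    · simp only [flipGallery]
      split_ifs
      · exact r_panel hα k g2
      · exact g2

lemma flip_pos (hα : α ∈ D.Φ) (k : ℤ) {L : Set ℕ} {γ : PreGallery n} (hγ : IsGallery D γ)
    (hL : ∀ i, 1 ≤ i → i ≤ γ.len + 1 → γ.p i ⊆ Hy α k ∨ (i - 1 ∈ L ↔ i ∈ L))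
    {A B : Set (V n)} (hAB : sRefl α (k : ℝ) '' A = B) (hB : ¬ B ⊆ Hy α k)
    (hother : ∀ β ∈ D.Φ, ∀ m : ℤ, Hy β (m : ℝ) ≠ Hy α k → ∀ X, sameSide β (m : ℝ) X B →
      sameSide β (m : ℝ) X A)
    (hpos : PositivelyFolded (alcoveOrient D A) γ)
    (hwall : ∀ i, 1 ≤ i → i ≤ γ.len → γ.p i ⊆ Hy α k →
      (flipGallery α (k : ℝ) L γ).c (i - 1) = (flipGallery α (k : ℝ) L γ).c i →
      Separates α (k : ℝ) ((flipGallery α (k : ℝ) L γ).c i) B) :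
    PositivelyFolded (alcoveOrient D B) (flipGallery α (k : ℝ) L γ) := by
  intro i hi hi' hfold
  by_cases hp : γ.p i ⊆ Hy α k
  · have hpan := ((flip_gallery hα k hγ hL).2.2.2 i hi hi').2
    refine orient_wall hα k hpan ?_ hB (hwall i hi hi' hp hfold)
    simp only [flipGallery, r_image_fix hp, ite_self]
    exact hp
  · have hLi := (hL i hi (le_trans hi' (Nat.le_succ _))).resolve_left hp
    simp only [flipGallery, hLi] at hfold ⊢
    split_ifs at hfold ⊢
    · have hfold' := congrArg (fun X => sRefl α (k : ℝ) '' X) hfold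
      simp only [rr_image hα] at hfold'
      rw [← hAB]
      exact r_orient hα k (hpos i hi hi' hfold')
    · have := hpos i hi hi' hfold
      intro β hβ m hpm hs
      refine this β hβ m hpm (hother β hβ m ?_ _ hs)
      intro heq
      rw [heq] at hpm
      exact hp hpm

/-- The core statement for two alcoves `A`, `B` which are adjacent along `H_{α,k}`. -/
lemma core (hα : α ∈ D.Φ) (k : ℤ) {A B : Set (V n)} (hAB : sRefl α (k : ℝ) '' A = B)
    (hA : A ⊆ Hle α k) (hB : B ⊆ Hge α k)
    (hA' : ¬ A ⊆ Hy α k) (hB' : ¬ B ⊆ Hy α k)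
    (hoBA : ∀ β ∈ D.Φ, ∀ m : ℤ, Hy β (m : ℝ) ≠ Hy α k → ∀ X, sameSide β (m : ℝ) X B →
      sameSide β (m : ℝ) X A)
    (hoAB : ∀ β ∈ D.Φ, ∀ m : ℤ, Hy β (m : ℝ) ≠ Hy α k → ∀ X, sameSide β (m : ℝ) X A →
      sameSide β (m : ℝ) X B)
    (γ : PreGallery n) (hσ : γ.p 0 ⊆ Hle α k) :
    Shadow D (alcoveOrient D B) γ = Shadow D (alcoveOrient D A) γ ∪
        (fun ζ => sRefl α (k : ℝ) '' ζ) ''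
          {ζ | ζ ∈ Shadow D (alcoveOrient D A) γ ∧ ζ ⊆ Hge α k} := by
  have hBA : sRefl α (k : ℝ) '' B = A := by rw [← hAB, rr_image hα]
  -- panels off the wall: neighbouring alcoves are on the same side
  have hnbr : ∀ γ' : PreGallery n, IsGallery D γ' → ∀ i, 1 ≤ i → i ≤ γ'.len → ¬ γ'.p i ⊆ Hy α k →
      (γ'.c (i - 1) ⊆ Hge α k ↔ γ'.c i ⊆ Hge α k) ∧
      (γ'.c (i - 1) ⊆ Hle α k ↔ γ'.c i ⊆ Hle α k) := by
    intro γ' hγ' i hi hi' hp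
    obtain ⟨g1, g2⟩ := hγ'.2.2.2 i hi hi'
    have s1 : γ'.p i ⊆ γ'.c (i - 1) := by
      obtain ⟨H, _, e⟩ := g1.2.2.1
      rw [e]; exact Set.inter_subset_left
    have s2 : γ'.p i ⊆ γ'.c i := by
      obtain ⟨H, _, e⟩ := g2.2.2.1
      rw [e]; exact Set.inter_subset_left
    have a1 := alcove_side hα k g1.1
    have a2 := alcove_side hα k g2.1
    have n1 : ¬ (γ'.c (i - 1) ⊆ Hge α k ∧ γ'.c (i - 1) ⊆ Hle α k) :=
      fun h => alcove_not_sub hα k g1.1 (sub_Hy h.1 h.2)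
    have n2 : ¬ (γ'.c i ⊆ Hge α k ∧ γ'.c i ⊆ Hle α k) :=
      fun h => alcove_not_sub hα k g2.1 (sub_Hy h.1 h.2)
    have b1 : ¬ (γ'.c (i - 1) ⊆ Hge α k ∧ γ'.c i ⊆ Hle α k) :=
      fun h => hp (sub_Hy (s1.trans h.1) (s2.trans h.2))
    have b2 : ¬ (γ'.c i ⊆ Hge α k ∧ γ'.c (i - 1) ⊆ Hle α k) :=
      fun h => hp (sub_Hy (s2.trans h.1) (s1.trans h.2))
    tauto
  apply Set.Subset.antisymm
  · rintro ζ ⟨γ', hγ', hty, h0, hpos, rfl⟩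
    set L : Set ℕ := {i | (∃ j ≤ i, γ'.p j ⊆ Hy α k) ∧ γ'.c (min i γ'.len) ⊆ Hle α k} with hLdef
    have hL : ∀ i, 1 ≤ i → i ≤ γ'.len + 1 → γ'.p i ⊆ Hy α k ∨ (i - 1 ∈ L ↔ i ∈ L) := by
      intro i hi hi'
      by_cases hp : γ'.p i ⊆ Hy α k
      · exact Or.inl hp
      right
      have e1 : (∃ j ≤ i - 1, γ'.p j ⊆ Hy α k) ↔ (∃ j ≤ i, γ'.p j ⊆ Hy α k) := by
        constructor
        · rintro ⟨j, hj, h⟩; exact ⟨j, by omega, h⟩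
        · rintro ⟨j, hj, h⟩
          have : j ≠ i := by rintro rfl; exact hp h
          exact ⟨j, by omega, h⟩
      simp only [hLdef, Set.mem_setOf_eq, e1]
      refine and_congr_right fun _ => ?_
      rcases Nat.lt_or_ge γ'.len i with hl | hl
      · rw [show min (i - 1) γ'.len = γ'.len by omega, show min i γ'.len = γ'.len by omega]
      · rw [show min (i - 1) γ'.len = i - 1 by omega, show min i γ'.len = i by omega]
        exact (hnbr γ' hγ' i hi hl hp).2
    have hg := flip_gallery hα k hγ' hL
    have hpos' : PositivelyFolded (alcoveOrient D A) (flipGallery α (k : ℝ) L γ') := by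
      refine flip_pos hα k hγ' hL hBA hA' hoAB hpos fun i hi hi' hp _ => Or.inl ⟨?_, hA⟩
      simp only [flipGallery]
      have hmin : min i γ'.len = i := by omega
      split_ifs with hiL
      · refine r_Hle hα k ?_
        have := hiL.2
        rwa [hmin] at this
      · refine (alcove_side hα k (hγ'.1 i hi')).resolve_right fun h => hiL ⟨⟨i, le_rfl, hp⟩, ?_⟩
        rwa [hmin]
    have h0' : (flipGallery α (k : ℝ) L γ').p 0 = γ.p 0 := by
      rw [← h0]
      simp only [flipGallery]
      split_ifs with h
      · obtain ⟨⟨j, hj, hp⟩, -⟩ := h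
        have : j = 0 := by omega
        subst this
        exact r_image_fix hp
      · rfl
    have hmem : (flipGallery α (k : ℝ) L γ').p (γ'.len + 1) ∈ Shadow D (alcoveOrient D A) γ :=
      ⟨_, hg, same_type_flip hα k hty, h0', hpos', rfl⟩
    by_cases hl : γ'.len + 1 ∈ L
    · right
      simp only [flipGallery, if_pos hl] at hmem
      refine ⟨_, ⟨hmem, r_Hle hα k ?_⟩, rr_image hα k _⟩
      have := hl.2
      rw [show min (γ'.len + 1) γ'.len = γ'.len by omega] at this
      exact hγ'.2.2.1.2.trans this
    · left
      simpa only [flipGallery, if_neg hl] using hmem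
  · rintro ζ (⟨γ', hγ', hty, h0, hpos, rfl⟩ | ⟨_, ⟨⟨γ', hγ', hty, h0, hpos, rfl⟩, hζ⟩, rfl⟩)
    · set L : Set ℕ := {i | (∃ j, i < j ∧ j ≤ γ'.len + 1 ∧ γ'.p j ⊆ Hy α k) ∧ γ'.c i ⊆ Hge α k}
        with hLdef
      have hL : ∀ i, 1 ≤ i → i ≤ γ'.len + 1 → γ'.p i ⊆ Hy α k ∨ (i - 1 ∈ L ↔ i ∈ L) := by
        intro i hi hi'
        by_cases hp : γ'.p i ⊆ Hy α k
        · exact Or.inl hp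
        right
        have e1 : (∃ j, i - 1 < j ∧ j ≤ γ'.len + 1 ∧ γ'.p j ⊆ Hy α k) ↔
            (∃ j, i < j ∧ j ≤ γ'.len + 1 ∧ γ'.p j ⊆ Hy α k) := by
          constructor
          · rintro ⟨j, hj, hj', h⟩
            have : j ≠ i := by rintro rfl; exact hp h
            exact ⟨j, by omega, hj', h⟩
          · rintro ⟨j, hj, h⟩; exact ⟨j, by omega, h⟩
        simp only [hLdef, Set.mem_setOf_eq, e1]
        refine and_congr_right fun ⟨j, hj, hj', _⟩ => ?_
        exact (hnbr γ' hγ' i hi (by omega) hp).1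
      have hg := flip_gallery hα k hγ' hL
      have hpos' : PositivelyFolded (alcoveOrient D B) (flipGallery α (k : ℝ) L γ') := by
        refine flip_pos hα k hγ' hL hAB hB' hoBA hpos fun i hi hi' hp hf => Or.inr ⟨?_, hB⟩
        rw [← hf]
        simp only [flipGallery]
        split_ifs with hiL
        · exact r_Hge hα k hiL.2
        · refine (alcove_side hα k (hγ'.1 (i - 1) (by omega))).resolve_left fun h =>
            hiL ⟨⟨i, by omega, by omega, hp⟩, h⟩
      have h0' : (flipGallery α (k : ℝ) L γ').p 0 = γ.p 0 := by
        rw [← h0]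
        simp only [flipGallery]
        split_ifs with h
        · apply r_image_fix
          exact sub_Hy (hγ'.2.1.2.trans h.2) (by rw [h0]; exact hσ)
        · rfl
      refine ⟨_, hg, same_type_flip hα k hty, h0', hpos', ?_⟩
      have : γ'.len + 1 ∉ L := by
        rintro ⟨⟨j, hj, hj', _⟩, -⟩; omega
      simp only [flipGallery, if_neg this]
    · set L : Set ℕ := {i | γ'.c (min i γ'.len) ⊆ Hge α k} with hLdef
      have hL : ∀ i, 1 ≤ i → i ≤ γ'.len + 1 → γ'.p i ⊆ Hy α k ∨ (i - 1 ∈ L ↔ i ∈ L) := by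
        intro i hi hi'
        by_cases hp : γ'.p i ⊆ Hy α k
        · exact Or.inl hp
        right
        simp only [hLdef, Set.mem_setOf_eq]
        rcases Nat.lt_or_ge γ'.len i with hl | hl
        · rw [show min (i - 1) γ'.len = γ'.len by omega, show min i γ'.len = γ'.len by omega]
        · rw [show min (i - 1) γ'.len = i - 1 by omega, show min i γ'.len = i by omega]
          exact (hnbr γ' hγ' i hi hl hp).1
      have hg := flip_gallery hα k hγ' hL
      have hpos' : PositivelyFolded (alcoveOrient D B) (flipGallery α (k : ℝ) L γ') := by
        refine flip_pos hα k hγ' hL hAB hB' hoBA hpos fun i hi hi' hp hf => Or.inr ⟨?_, hB⟩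
        have hmin : min i γ'.len = i := by omega
        simp only [flipGallery]
        split_ifs with hiL
        · refine r_Hge hα k ?_
          have : γ'.c (min i γ'.len) ⊆ Hge α k := hiL
          rwa [hmin] at this
        · refine (alcove_side hα k (hγ'.1 i hi')).resolve_left fun h => hiL ?_
          show γ'.c (min i γ'.len) ⊆ Hge α k
          rwa [hmin]
      have h0' : (flipGallery α (k : ℝ) L γ').p 0 = γ.p 0 := by
        rw [← h0]
        simp only [flipGallery]
        split_ifs with h
        · apply r_image_fix
          have h' : γ'.c (min 0 γ'.len) ⊆ Hge α k := h
          rw [Nat.zero_min] at h'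
          exact sub_Hy (hγ'.2.1.2.trans h') (by rw [h0]; exact hσ)
        · rfl
      refine ⟨_, hg, same_type_flip hα k hty, h0', hpos', ?_⟩
      simp only [flipGallery]
      split_ifs with hl
      · rfl
      · apply r_image_fix
        refine sub_Hy hζ (hγ'.2.2.1.2.trans ?_)
        refine (alcove_side hα k (hγ'.1 _ le_rfl)).resolve_left fun h => hl ?_
        show γ'.c (min (γ'.len + 1) γ'.len) ⊆ Hge α k
        rwa [show min (γ'.len + 1) γ'.len = γ'.len by omega]

end Transport

lemma other_walls (D : RootData n) (y s : AffW D) (hs : s ∈ SGen D) {α : V n} (hα : α ∈ D.Φ)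
    (k : ℤ) (hsep : Separates α (k : ℝ) (actW y (fund D)) (actW (y * s) (fund D)))
    {β : V n} (hβ : β ∈ D.Φ) (m : ℤ) (hne : Hy β (m : ℝ) ≠ Hy α k) :
    (actW y (fund D) ⊆ Hge β m ↔ actW (y * s) (fund D) ⊆ Hge β m) ∧
    (actW y (fund D) ⊆ Hle β m ↔ actW (y * s) (fund D) ⊆ Hle β m) := by
  have h1 : ¬ Separates β (m : ℝ) (actW y (fund D)) (actW (y * s) (fund D)) := by
    intro h
    apply hne
    have e1 := sep_unique D y hs hα k hsep
    have e2 := sep_unique D y hs hβ m h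
    ext v
    rw [← sRefl_fix_iff (inner_self_ne hβ), ← sRefl_fix_iff (inner_self_ne hα)]
    obtain ⟨w, rfl⟩ := y.1.surjective v
    rw [← e1, ← e2]
  have a1 := actW_side D y hβ m
  have a2 := actW_side D (y * s) hβ m
  have b1 := fun h h' => actW_not_both D y hβ m h h'
  have b2 := fun h h' => actW_not_both D (y * s) hβ m h h'
  unfold Separates at h1
  tauto

lemma main_ge (D : RootData n) (σ : Set (V n)) (hσf : σ ⊆ fund D)
    (y s : AffW D) (hs : s ∈ SGen D) (hlen : lenW D y < lenW D (y * s))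
    (α : V n) (hα : α ∈ D.Φ) (k : ℤ)
    (hsep : Separates α (k : ℝ) (actW y (fund D)) (actW (y * s) (fund D)))
    (hB : actW (y * s) (fund D) ⊆ Hge α (k : ℝ))
    (γ : PreGallery n) (hfirst : γ.p 0 = σ) :
    Shadow D (alcoveOrient D (actW (y * s) (fund D))) γ =
      Shadow D (alcoveOrient D (actW y (fund D))) γ ∪
        (fun ζ => sRefl α (k : ℝ) '' ζ) ''
          {ζ | ζ ∈ Shadow D (alcoveOrient D (actW y (fund D))) γ ∧ ζ ⊆ Hge α k} := by
  have hA : actW y (fund D) ⊆ Hle α k := by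
    rcases hsep with ⟨-, h⟩ | ⟨h, -⟩
    · exact (actW_not_both D (y * s) hα k hB h).elim
    · exact h
  have hys := sep_unique D y hs hα k hsep
  have hnot : ∀ z : AffW D, ¬ actW z (fund D) ⊆ Hy α k := fun z h =>
    actW_not_both D z hα k (fun v hv => (h hv).ge) (fun v hv => (h hv).le)
  refine core hα k ?_ hA hB (hnot _) (hnot _) ?_ ?_ γ ?_
  · rw [actW, actW, Set.image_image]
    exact Set.image_congr fun v _ => (hys v).symm
  · intro β hβ m hne X h
    obtain ⟨h1, h2⟩ := other_walls D y s hs hα k hsep hβ m hne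
    unfold sameSide at *
    rwa [h1, h2]
  · intro β hβ m hne X h
    obtain ⟨h1, h2⟩ := other_walls D y s hs hα k hsep hβ m hne
    unfold sameSide at *
    rwa [← h1, ← h2]
  · rw [hfirst]
    exact hσf.trans (fund_Hle D y s hs hlen hα k hA hB)

lemma sRefl_neg (α : V n) (k : ℝ) : sRefl (-α) (-k) = sRefl α k := by
  funext v
  simp only [sRefl, coroot, inner_neg_left, inner_neg_right, neg_neg]
  module

end ShadowRec

/-- Theorem: recursive description of shadows, simplex version. -/
theorem shadow_recursion_simplex {n : ℕ} (D : RootData n)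
    (σ τ : Set (V n))
    (hσ : IsFace D σ) (hσf : σ ⊆ fund D) (hσ0 : (0 : V n) ∈ σ)
    (hτ : IsFace D τ) (hτf : τ ⊆ fund D) (hτ0 : (0 : V n) ∈ τ)
    (x y s : AffW D) (hs : s ∈ SGen D) (hlen : lenW D y < lenW D (y * s))
    (α : V n) (hα : α ∈ D.Φ) (k : ℤ)
    (hsep : Separates α (k : ℝ) (actW y (fund D)) (actW (y * s) (fund D)))
    (Hys : Set (V n))
    (hHys : (Hys = Hge α (k : ℝ) ∧ actW (y * s) (fund D) ⊆ Hge α (k : ℝ)) ∨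
            (Hys = Hle α (k : ℝ) ∧ actW (y * s) (fund D) ⊆ Hle α (k : ℝ)))
    (γ : PreGallery n) (hmin : IsMinimal D γ)
    (hfirst : γ.p 0 = σ) (hlast : γ.p (γ.len + 1) = actW x τ) :
    Shadow D (alcoveOrient D (actW (y * s) (fund D))) γ =
      Shadow D (alcoveOrient D (actW y (fund D))) γ ∪
        (fun ζ => sRefl α (k : ℝ) '' ζ) ''
          {ζ | ζ ∈ Shadow D (alcoveOrient D (actW y (fund D))) γ ∧ ζ ⊆ Hys} := by
  rcases hHys with ⟨rfl, hB⟩ | ⟨rfl, hB⟩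
  · exact ShadowRec.main_ge D σ hσf y s hs hlen α hα k hsep hB γ hfirst
  · have h := ShadowRec.main_ge D σ hσf y s hs hlen (-α) (D.neg_mem α hα) (-k)
      (by
        push_cast
        simp only [Separates, ShadowRec.Hge_neg, ShadowRec.Hle_neg] at hsep ⊢
        exact hsep.symm)
      (by
        push_cast
        rw [ShadowRec.Hge_neg]
        exact hB) γ hfirst
    push_cast at h
    rw [ShadowRec.Hge_neg, ShadowRec.sRefl_neg] at h
    exact h
end

section
/- Let λ be any element of the coroot lattice R^∨. For any y ∈ W and s ∈ S such that ℓ(ys) > ℓ(y), one has Sh_{𝐲𝐬}(λ) = Sh_𝐲(λ) ∪ r_H({μ ∈ Sh_𝐲(λ) : μ ∈ H^{ys}}), where H is the unique hyperplane separating the adjacent alcoves y·𝐚_f and ys·𝐚_f, r_H is the reflection in H, and H^{ys} is the closed half-space bounded by H containing ys·𝐚_f. -/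
open scoped RealInnerProductSpace
open scoped Classical

section ShadowProof

variable {n : ℕ}

lemma inner_self_ne (D : RootData n) {α : V n} (hα : α ∈ D.Φ) : (⟪α, α⟫ : ℝ) ≠ 0 :=
  inner_self_ne_zero.mpr (D.nonzero α hα)

lemma inner_sRefl (α β : V n) (k : ℝ) (v : V n) :
    (⟪β, sRefl α k v⟫ : ℝ) = ⟪β, v⟫ - (⟪α, v⟫ - k) * (2 / ⟪α, α⟫ * ⟪α, β⟫) := by
  simp only [sRefl, coroot, inner_sub_right, inner_smul_right, real_inner_comm α β]

lemma inner_sRefl_self (α : V n) (h : (⟪α, α⟫ : ℝ) ≠ 0) (k : ℝ) (v : V n) :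
    (⟪α, sRefl α k v⟫ : ℝ) = 2 * k - ⟪α, v⟫ := by
  rw [inner_sRefl]; field_simp; ring

lemma sRefl_invol (α : V n) (h : (⟪α, α⟫ : ℝ) ≠ 0) (k : ℝ) (v : V n) :
    sRefl α k (sRefl α k v) = v := by
  have := inner_sRefl_self α h k v
  rw [sRefl, this, sRefl]
  module

lemma sRefl_fixed (α : V n) (k : ℝ) (v : V n) (hv : v ∈ Hy α k) : sRefl α k v = v := by
  have : (⟪α, v⟫ : ℝ) = k := hv
  simp [sRefl, this]

lemma sRefl_fixed_iff (α : V n) (h : (⟪α, α⟫ : ℝ) ≠ 0) (k : ℝ) (v : V n) :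
    sRefl α k v = v ↔ v ∈ Hy α k := by
  refine ⟨fun hv => ?_, sRefl_fixed α k v⟩
  have := inner_sRefl_self α h k v
  rw [hv] at this
  show (⟪α, v⟫ : ℝ) = k
  linarith

/-- The reflection as a homeomorphism. -/
noncomputable def reflHomeo (α : V n) (h : (⟪α, α⟫ : ℝ) ≠ 0) (k : ℝ) : V n ≃ₜ V n where
  toFun := sRefl α k
  invFun := sRefl α k
  left_inv := sRefl_invol α h k
  right_inv := sRefl_invol α h k
  continuous_toFun := by unfold sRefl; fun_prop
  continuous_invFun := by unfold sRefl; fun_prop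

lemma sRefl_mem_AffW (D : RootData n) {α : V n} (hα : α ∈ D.Φ) (k : ℤ) :
    (reflHomeo α (inner_self_ne D hα) (k : ℝ)).toEquiv ∈ AffW D :=
  Subgroup.subset_closure ⟨α, hα, k, rfl⟩

lemma refl_key (D : RootData n) {α : V n} (hα : α ∈ D.Φ) (k : ℤ) {β : V n} (hβ : β ∈ D.Φ) :
    ∃ β' ∈ D.Φ, ∃ j : ℤ, (∀ v, (⟪β, sRefl α k v⟫ : ℝ) = ⟪β', v⟫ + j) ∧
      ∀ (m : ℝ) v, sRefl β m (sRefl α k v) = sRefl α k (sRefl β' (m - j) v) := by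
  obtain ⟨c, hc⟩ := D.crystallographic α hα β hβ
  have h0 := inner_self_ne D hα
  have h1 := inner_self_ne D hβ
  have key : ∀ v, (⟪β, sRefl α k v⟫ : ℝ) =
      ⟪β - (2 * ⟪α, β⟫ / ⟪α, α⟫ : ℝ) • α, v⟫ + ((k * c : ℤ) : ℝ) := by
    intro v
    rw [inner_sRefl, inner_sub_left, inner_smul_left]
    push_cast
    rw [← hc]
    simp only [conj_trivial]
    ring
  refine ⟨_, D.reflect_mem α hα β hβ, k * c, key, ?_⟩
  intro m v
  have hn : (⟪β - (2 * ⟪α, β⟫ / ⟪α, α⟫ : ℝ) • α, β - (2 * ⟪α, β⟫ / ⟪α, α⟫ : ℝ) • α⟫ : ℝ)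
      = ⟪β, β⟫ := by
    simp only [inner_sub_left, inner_sub_right, inner_smul_left, inner_smul_right,
      conj_trivial, real_inner_comm α β]
    field_simp
    ring
  have e1 : sRefl β m (sRefl α k v) = sRefl α k v -
      (⟪β - (2 * ⟪α, β⟫ / ⟪α, α⟫ : ℝ) • α, v⟫ + ((k * c : ℤ) : ℝ) - m) • coroot β := by
    conv_lhs => rw [sRefl]
    rw [key]
  rw [e1]
  set t : ℝ := ⟪β - (2 * ⟪α, β⟫ / ⟪α, α⟫ : ℝ) • α, v⟫ + ((k * c : ℤ) : ℝ) - m with ht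
  have e2 : sRefl (β - (2 * ⟪α, β⟫ / ⟪α, α⟫ : ℝ) • α) (m - ((k * c : ℤ) : ℝ)) v =
      v - t • coroot (β - (2 * ⟪α, β⟫ / ⟪α, α⟫ : ℝ) • α) := by
    rw [sRefl, ht]; congr 2; ring
  rw [e2]
  have hin : (⟪α, coroot (β - (2 * ⟪α, β⟫ / ⟪α, α⟫ : ℝ) • α)⟫ : ℝ) =
      - (2 / ⟪β, β⟫ * ⟪α, β⟫) := by
    rw [coroot, hn]
    simp only [inner_sub_right, inner_smul_right]
    field_simp
    ring
  conv_rhs => rw [sRefl, inner_sub_right, inner_smul_right, hin, coroot, hn]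
  simp only [sRefl, coroot]
  match_scalars <;> field_simp <;> ring

/-- The transformation property of affine Weyl group elements. -/
def Good (D : RootData n) (x : Equiv.Perm (V n)) : Prop :=
  ∀ β ∈ D.Φ, ∃ β' ∈ D.Φ, ∃ j : ℤ, (∀ v, (⟪β, x v⟫ : ℝ) = ⟪β', v⟫ + j) ∧
      ∀ (m : ℝ) v, sRefl β m (x v) = x (sRefl β' (m - j) v)

lemma Good.mul {D : RootData n} {x y : Equiv.Perm (V n)} (hx : Good D x) (hy : Good D y) :
    Good D (x * y) := by
  intro β hβ
  obtain ⟨β', hβ', j, h1, h2⟩ := hx β hβ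
  obtain ⟨β'', hβ'', j', h3, h4⟩ := hy β' hβ'
  refine ⟨β'', hβ'', j' + j, fun v => ?_, fun m v => ?_⟩
  · rw [Equiv.Perm.mul_apply, h1, h3]; push_cast; ring
  · rw [Equiv.Perm.mul_apply, Equiv.Perm.mul_apply, h2, h4]
    congr 3; push_cast; ring

lemma good_affW (D : RootData n) (x : Equiv.Perm (V n)) (hx : x ∈ AffW D) : Good D x := by
  suffices h : Good D x ∧ Good D x⁻¹ from h.1
  induction hx using Subgroup.closure_induction with
  | mem x hx =>
    obtain ⟨α, hα, k, hk⟩ := hx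
    have hinv : x⁻¹ = x := by
      rw [inv_eq_iff_mul_eq_one]
      ext1 v
      rw [Equiv.Perm.mul_apply, hk, sRefl_invol α (inner_self_ne D hα)]; rfl
    rw [hinv, and_self]
    intro β hβ
    rw [hk]
    exact refl_key D hα k hβ
  | one =>
    have : Good D 1 := fun β hβ => ⟨β, hβ, 0, by simp, by simp⟩
    simpa using this
  | mul x y _ _ hx hy =>
    rw [mul_inv_rev]
    exact ⟨hx.1.mul hy.1, hy.2.mul hx.2⟩
  | inv x _ hx =>
    rw [inv_inv]; exact ⟨hx.2, hx.1⟩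

/-! ### The fundamental alcove -/

lemma exists_dual (D : RootData n) (c : Fin n → ℝ) :
    ∃ v : V n, ∀ i, (⟪D.simple i, v⟫ : ℝ) = c i := by
  let f : V n →ₗ[ℝ] (Fin n → ℝ) := LinearMap.pi fun i => (innerₛₗ ℝ (D.simple i))
  have hsp : Submodule.span ℝ (Set.range D.simple) = ⊤ :=
    D.simple_indep.span_eq_top_of_card_eq_finrank' (by simp)
  have hinj : Function.Injective f := by
    rw [injective_iff_map_eq_zero]
    intro v hv
    have h1 : ∀ i, (⟪D.simple i, v⟫ : ℝ) = 0 := fun i => congrFun hv i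
    have h2 : ∀ w ∈ Submodule.span ℝ (Set.range D.simple), (⟪w, v⟫ : ℝ) = 0 := by
      intro w hw
      induction hw using Submodule.span_induction with
      | mem w hw => obtain ⟨i, rfl⟩ := hw; exact h1 i
      | zero => simp
      | add x y _ _ hx hy => rw [inner_add_left, hx, hy, add_zero]
      | smul a x _ hx => rw [inner_smul_left, hx, mul_zero]
    exact inner_self_eq_zero.mp (h2 v (by rw [hsp]; trivial))
  have hsurj : Function.Surjective f :=
    (LinearMap.injective_iff_surjective_of_finrank_eq_finrank (by simp)).mp hinj
  obtain ⟨v, hv⟩ := hsurj c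
  exact ⟨v, fun i => congrFun hv i⟩

lemma root_combo (D : RootData n) {β : V n} (hβ : β ∈ D.Φ) :
    ∃ b : Fin n → ℝ, β = ∑ i, b i • D.simple i := by
  rcases D.pos_total β hβ with h | h
  · obtain ⟨c, _, hc⟩ := D.pos_combo β h; exact ⟨c, hc⟩
  · obtain ⟨c, _, hc⟩ := D.pos_combo _ h
    refine ⟨-c, ?_⟩
    rw [← neg_neg β, hc]; simp [neg_smul]

lemma inner_combo (D : RootData n) (b c : Fin n → ℝ) (v : V n)
    (hv : ∀ i, (⟪D.simple i, v⟫ : ℝ) = c i) :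
    (⟪∑ i, b i • D.simple i, v⟫ : ℝ) = ∑ i, b i * c i := by
  rw [sum_inner]
  exact Finset.sum_congr rfl fun i _ => by rw [inner_smul_left, hv]; simp

/-- The vertices of the fundamental alcove away from `0`. -/
lemma exists_vertex (D : RootData n) : ∃ a : Fin n → ℝ, (∀ j, 0 < a j) ∧
    D.highest = ∑ i, a i • D.simple i ∧
    ∀ j, ∃ v ∈ fund D, (⟪D.highest, v⟫ : ℝ) = 1 ∧ (∀ i, i ≠ j → (⟪D.simple i, v⟫ : ℝ) = 0) ∧
      ∀ b : Fin n → ℝ, (⟪∑ i, b i • D.simple i, v⟫ : ℝ) = b j / a j := by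
  obtain ⟨a, ha0, ha⟩ := D.pos_combo _ D.highest_mem
  have ha1 : ∀ j, 0 < a j := by
    intro j
    obtain ⟨d, hd0, hd⟩ := D.highest_dominates _ (D.simple_mem j)
    obtain ⟨v, hv⟩ := exists_dual D (Pi.single j 1)
    have h1 := inner_combo D a _ v hv
    have h2 := inner_combo D d _ v hv
    rw [← ha] at h1
    rw [← hd, inner_sub_left, h1, hv] at h2
    simp [Pi.single_apply] at h2
    have := hd0 j
    linarith
  refine ⟨a, ha1, ha, fun j => ?_⟩
  obtain ⟨v, hv⟩ := exists_dual D (Pi.single j (1 / a j))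
  have hb : ∀ b : Fin n → ℝ, (⟪∑ i, b i • D.simple i, v⟫ : ℝ) = b j / a j := by
    intro b
    rw [inner_combo D b _ v hv]
    simp [Pi.single_apply, div_eq_mul_inv]
  have hth : (⟪D.highest, v⟫ : ℝ) = 1 := by
    rw [ha, hb]; exact div_self (ha1 j).ne'
  refine ⟨v, ⟨fun i => ?_, hth.le⟩, hth, fun i hi => ?_, hb⟩
  · rw [hv]
    by_cases hij : i = j
    · subst hij; simp [(ha1 i).le]
    · simp [hij]
  · rw [hv]; simp [hi]

lemma zero_mem_fund (D : RootData n) : (0 : V n) ∈ fund D := by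
  simp [fund]

lemma fund_side (D : RootData n) {β : V n} (hβ : β ∈ D.Φ) (m : ℤ) :
    fund D ⊆ Hge β m ∨ fund D ⊆ Hle β m := by
  have hp : ∀ β ∈ D.pos, ∀ v ∈ fund D, 0 ≤ (⟪β, v⟫ : ℝ) ∧ (⟪β, v⟫ : ℝ) ≤ 1 := by
    intro β hβ v hv
    have hnn : ∀ c : Fin n → ℝ, (∀ i, 0 ≤ c i) →
        0 ≤ (⟪∑ i, c i • D.simple i, v⟫ : ℝ) := by
      intro c hc
      rw [inner_combo D c _ v (fun i => rfl)]
      exact Finset.sum_nonneg fun i _ => mul_nonneg (hc i) (hv.1 i)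
    obtain ⟨c, hc, hc'⟩ := D.pos_combo β hβ
    obtain ⟨d, hd, hd'⟩ := D.highest_dominates β hβ
    have h1 := hnn c hc
    have h2 := hnn d hd
    rw [← hc'] at h1
    rw [← hd', inner_sub_left] at h2
    have h3 := hv.2
    exact ⟨h1, by linarith⟩
  rcases D.pos_total β hβ with h | h
  · rcases le_or_gt m 0 with hm | hm
    · left; intro v hv
      have : (m : ℝ) ≤ 0 := by exact_mod_cast hm
      exact this.trans (hp β h v hv).1
    · right; intro v hv
      have : (1 : ℝ) ≤ m := by exact_mod_cast hm
      exact (hp β h v hv).2.trans this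
  · rcases le_or_gt 0 m with hm | hm
    · right; intro v hv
      have h1 := (hp _ h v hv).1
      have : (0 : ℝ) ≤ m := by exact_mod_cast hm
      rw [inner_neg_left] at h1
      show (⟪β, v⟫ : ℝ) ≤ m
      linarith
    · left; intro v hv
      have h1 := (hp _ h v hv).2
      have : (m : ℝ) ≤ -1 := by exact_mod_cast (by omega : m ≤ -1)
      rw [inner_neg_left] at h1
      show (m : ℝ) ≤ (⟪β, v⟫ : ℝ)
      linarith

lemma fund_not_sub (D : RootData n) {β : V n} (hβ : β ∈ D.Φ) (m : ℝ) : ¬ fund D ⊆ Hy β m := by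
  intro h
  have h0 : (⟪β, (0 : V n)⟫ : ℝ) = m := h (zero_mem_fund D)
  rw [inner_zero_right] at h0
  obtain ⟨a, ha, _, hv⟩ := exists_vertex D
  obtain ⟨b, hb⟩ := root_combo D hβ
  apply D.nonzero β hβ
  rw [hb]
  refine Finset.sum_eq_zero fun j _ => ?_
  obtain ⟨v, hvf, _, _, hvb⟩ := hv j
  have h1 : (⟪β, v⟫ : ℝ) = m := h hvf
  rw [hb, hvb, ← h0, div_eq_zero_iff] at h1
  rcases h1 with h1 | h1
  · rw [h1, zero_smul]
  · exact absurd h1 (ha j).ne'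

lemma sep_mem {β : V n} {m : ℝ} {X Y : Set (V n)} (h : Separates β m X Y) {v : V n}
    (hX : v ∈ X) (hY : v ∈ Y) : (⟪β, v⟫ : ℝ) = m := by
  rcases h with h | h
  · exact le_antisymm (h.2 hY) (h.1 hX)
  · exact le_antisymm (h.1 hX) (h.2 hY)

lemma sRefl_neg (α : V n) (k : ℝ) : sRefl (-α) (-k) = sRefl α k := by
  funext v
  simp only [sRefl, coroot, inner_neg_left, inner_neg_right]
  module

lemma sep_fund (D : RootData n) (s : AffW D) (hs : s ∈ SGen D) {β : V n} (hβ : β ∈ D.Φ) (m : ℝ)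
    (h : Separates β m (fund D) (actW s (fund D))) :
    ⇑(s : Equiv.Perm (V n)) = sRefl β m := by
  obtain ⟨a, ha, hha, hv⟩ := exists_vertex D
  obtain ⟨b, hb⟩ := root_combo D hβ
  rcases hs with hs | ⟨i, hs⟩
  · have hbm : ∀ j, b j = m * a j := by
      intro j
      obtain ⟨v, hvf, hv1, _, hvb⟩ := hv j
      have hfix : (s : Equiv.Perm (V n)) v = v := by
        rw [hs]; exact sRefl_fixed _ _ _ hv1
      have h1 := sep_mem h hvf ⟨v, hvf, hfix⟩
      rw [hb, hvb, div_eq_iff (ha j).ne'] at h1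
      exact h1
    have hbeq : β = m • D.highest := by
      rw [hb, hha, Finset.smul_sum]
      exact Finset.sum_congr rfl fun j _ => by rw [hbm, mul_smul]
    rcases D.reduced _ (D.pos_sub D.highest_mem) m (hbeq ▸ hβ) with h1 | h1
    · rw [hs, hbeq, h1, one_smul]
    · rw [hs, hbeq, h1, neg_smul, one_smul, sRefl_neg]
  · have hm : m = 0 := by
      have hfix : (s : Equiv.Perm (V n)) 0 = 0 := by
        rw [hs]; exact sRefl_fixed _ _ _ (by simp [Hy])
      have h1 := sep_mem h (zero_mem_fund D) ⟨0, zero_mem_fund D, hfix⟩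
      rw [inner_zero_right] at h1
      exact h1.symm
    have hbj : ∀ j, j ≠ i → b j = 0 := by
      intro j hj
      obtain ⟨v, hvf, _, hv0, hvb⟩ := hv j
      have hfix : (s : Equiv.Perm (V n)) v = v := by
        rw [hs]; exact sRefl_fixed _ _ _ (hv0 i hj.symm)
      have h1 := sep_mem h hvf ⟨v, hvf, hfix⟩
      rw [hb, hvb, hm, div_eq_zero_iff] at h1
      exact h1.resolve_right (ha j).ne'
    have hbeq : β = b i • D.simple i := by
      rw [hb]
      refine Finset.sum_eq_single i (fun j _ hj => by rw [hbj j hj, zero_smul]) (by simp)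
    rcases D.reduced _ (D.pos_sub (D.simple_mem i)) (b i) (hbeq ▸ hβ) with h1 | h1
    · rw [hs, hm, hbeq, h1, one_smul]
    · rw [hs, hm, hbeq, h1, neg_smul, one_smul]
      conv_rhs => rw [← neg_zero, sRefl_neg]

lemma actW_mul {D : RootData n} (x y : AffW D) (A : Set (V n)) :
    actW (x * y) A = actW x (actW y A) := by
  simp [actW, Set.image_image]

lemma actW_side (D : RootData n) (y : AffW D) {β : V n} (hβ : β ∈ D.Φ) (m : ℤ) :
    actW y (fund D) ⊆ Hge β m ∨ actW y (fund D) ⊆ Hle β m := by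
  obtain ⟨β', hβ', j, h1, _⟩ := good_affW D y y.2 β hβ
  rcases fund_side D hβ' (m - j) with h | h
  · left; rintro _ ⟨v, hv, rfl⟩
    have := h hv
    simp only [Hge, Set.mem_ofPred_eq, h1] at this ⊢
    push_cast at this; linarith
  · right; rintro _ ⟨v, hv, rfl⟩
    have := h hv
    simp only [Hle, Set.mem_ofPred_eq, h1] at this ⊢
    push_cast at this; linarith

lemma actW_not_sub (D : RootData n) (y : AffW D) {β : V n} (hβ : β ∈ D.Φ) (m : ℝ) :
    ¬ actW y (fund D) ⊆ Hy β m := by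
  obtain ⟨β', hβ', j, h1, _⟩ := good_affW D y y.2 β hβ
  intro h
  apply fund_not_sub D hβ' (m - j)
  intro v hv
  have := h ⟨v, hv, rfl⟩
  simp only [Hy, Set.mem_ofPred_eq, h1] at this ⊢
  linarith

lemma sep_conj (D : RootData n) (y s : AffW D) (hs : s ∈ SGen D) {β : V n} (hβ : β ∈ D.Φ) (m : ℝ)
    (h : Separates β m (actW y (fund D)) (actW (y * s) (fund D))) (v : V n) :
    sRefl β m ((y : Equiv.Perm (V n)) v) =
      (y : Equiv.Perm (V n)) ((s : Equiv.Perm (V n)) v) := by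
  obtain ⟨β', hβ', j, h1, h2⟩ := good_affW D y y.2 β hβ
  rw [h2, sep_fund D s hs hβ' (m - j)]
  rw [actW_mul] at h
  have hge : ∀ X : Set (V n), actW y X ⊆ Hge β m → X ⊆ Hge β' (m - j) := by
    intro X hX v hv
    have := hX ⟨v, hv, rfl⟩
    simp only [Hge, Set.mem_ofPred_eq, h1] at this ⊢
    linarith
  have hle : ∀ X : Set (V n), actW y X ⊆ Hle β m → X ⊆ Hle β' (m - j) := by
    intro X hX v hv
    have := hX ⟨v, hv, rfl⟩
    simp only [Hle, Set.mem_ofPred_eq, h1] at this ⊢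
    linarith
  exact h.imp (fun h => ⟨hge _ h.1, hle _ h.2⟩) (fun h => ⟨hle _ h.1, hge _ h.2⟩)

lemma sgen_sq (D : RootData n) (s : AffW D) (hs : s ∈ SGen D) (v : V n) :
    (s : Equiv.Perm (V n)) ((s : Equiv.Perm (V n)) v) = v := by
  rcases hs with hs | ⟨i, hs⟩
  · rw [hs]; exact sRefl_invol _ (inner_self_ne D (D.pos_sub D.highest_mem)) _ _
  · rw [hs]; exact sRefl_invol _ (inner_self_ne D (D.pos_sub (D.simple_mem i))) _ _

lemma exchange (D : RootData n) {α : V n} (hα : α ∈ D.Φ) (k : ℤ) (hf : fund D ⊆ Hle α k)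
    (l : List (AffW D)) (hl : ∀ s ∈ l, s ∈ SGen D) (hy : actW l.prod (fund D) ⊆ Hge α k) :
    ∃ l' : List (AffW D), (∀ s ∈ l', s ∈ SGen D) ∧ l'.length < l.length ∧
      ∀ v, sRefl α k ((l.prod : Equiv.Perm (V n)) v) = (l'.prod : Equiv.Perm (V n)) v := by
  induction l using List.reverseRecOn with
  | nil =>
    exfalso
    apply fund_not_sub D hα k
    intro v hv
    exact le_antisymm (hf hv) (hy ⟨v, hv, rfl⟩)
  | append_singleton l t ih =>
    have hl0 : ∀ s ∈ l, s ∈ SGen D := fun s hs => hl s (by simp [hs])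
    have ht : t ∈ SGen D := hl t (by simp)
    rw [List.prod_append, List.prod_singleton] at hy ⊢
    rcases actW_side D l.prod hα k with h | h
    · obtain ⟨l', h1, h2, h3⟩ := ih hl0 h
      refine ⟨l' ++ [t], ?_, by simp [h2], fun v => ?_⟩
      · intro s hs
        rcases List.mem_append.mp hs with hs | hs
        · exact h1 s hs
        · rw [List.mem_singleton.mp hs]; exact ht
      · rw [List.prod_append, List.prod_singleton]
        exact h3 _
    · refine ⟨l, hl0, by simp, fun v => ?_⟩
      have := sep_conj D l.prod t ht hα k (Or.inr ⟨h, hy⟩) ((t : Equiv.Perm (V n)) v)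
      rw [sgen_sq D t ht] at this
      exact this

lemma fund_same_side (D : RootData n) (y s : AffW D) (hs : s ∈ SGen D)
    (hlen : lenW D y < lenW D (y * s)) {α : V n} (hα : α ∈ D.Φ) (k : ℤ)
    (hA : actW y (fund D) ⊆ Hge α k) (hB : actW (y * s) (fund D) ⊆ Hle α k) :
    fund D ⊆ Hge α k := by
  by_contra hcon
  have hf := (fund_side D hα k).resolve_left hcon
  have hne : {m | ∃ l : List (AffW D), (∀ s ∈ l, s ∈ SGen D) ∧ l.length = m ∧
      l.prod = y}.Nonempty := by
    have : {m | ∃ l : List (AffW D), (∀ s ∈ l, s ∈ SGen D) ∧ l.length = m ∧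
        l.prod = y * s}.Nonempty := by
      by_contra hem
      rw [Set.not_nonempty_iff_eq_empty] at hem
      rw [lenW, lenW, hem] at hlen
      simp at hlen
    obtain ⟨m, l, h1, h2, h3⟩ := this
    refine ⟨_, l ++ [s], ?_, rfl, ?_⟩
    · intro t ht
      rcases List.mem_append.mp ht with ht | ht
      · exact h1 t ht
      · rw [List.mem_singleton.mp ht]; exact hs
    · rw [List.prod_append, List.prod_singleton, h3, mul_assoc]
      have : s * s = 1 := by
        apply Subtype.ext
        ext1 v
        exact sgen_sq D s hs v
      rw [this, mul_one]
  obtain ⟨l, h1, h2, h3⟩ := Nat.sInf_mem hne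
  obtain ⟨l', h4, h5, h6⟩ := exchange D hα k hf l h1 (by rw [h3]; exact hA)
  have h7 : l'.prod = y * s := by
    apply Subtype.ext
    ext1 v
    rw [← h6 v, h3, sep_conj D y s hs hα k (Or.inl ⟨hA, hB⟩)]
    rfl
  have h8 : lenW D (y * s) ≤ l'.length := Nat.sInf_le ⟨l', h4, rfl, h7⟩
  have h9 : l.length = lenW D y := h2
  omega
/-! ### The reflection acts on faces, alcoves and panels -/

lemma image_invol (α : V n) (h : (⟪α, α⟫ : ℝ) ≠ 0) (k : ℝ) (X : Set (V n)) :
    sRefl α k '' (sRefl α k '' X) = X := by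
  rw [Set.image_image]
  simp [sRefl_invol α h k]

lemma image_fixed (α : V n) (k : ℝ) (X : Set (V n)) (hX : X ⊆ Hy α k) :
    sRefl α k '' X = X := by
  have : Set.EqOn (sRefl α k) id X := fun v hv => sRefl_fixed α k v (hX hv)
  rw [this.image_eq, Set.image_id]

lemma image_ge (α : V n) (h : (⟪α, α⟫ : ℝ) ≠ 0) (k : ℝ) (X : Set (V n)) (hX : X ⊆ Hge α k) :
    sRefl α k '' X ⊆ Hle α k := by
  rintro _ ⟨v, hv, rfl⟩
  have h1 : k ≤ ⟪α, v⟫ := hX hv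
  show (⟪α, sRefl α k v⟫ : ℝ) ≤ k
  rw [inner_sRefl_self α h]; linarith

lemma image_le (α : V n) (h : (⟪α, α⟫ : ℝ) ≠ 0) (k : ℝ) (X : Set (V n)) (hX : X ⊆ Hle α k) :
    sRefl α k '' X ⊆ Hge α k := by
  rintro _ ⟨v, hv, rfl⟩
  have h1 : ⟪α, v⟫ ≤ k := hX hv
  show k ≤ (⟪α, sRefl α k v⟫ : ℝ)
  rw [inner_sRefl_self α h]; linarith

lemma image_sub_Hy (α : V n) (h : (⟪α, α⟫ : ℝ) ≠ 0) (k : ℝ) (X : Set (V n)) :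
    sRefl α k '' X ⊆ Hy α k ↔ X ⊆ Hy α k := by
  constructor
  · intro hX
    have := image_fixed α k _ hX
    rw [image_invol α h] at this
    rwa [← this] at hX
  · intro hX
    rwa [image_fixed α k X hX]

lemma image_mem_iff (α : V n) (h : (⟪α, α⟫ : ℝ) ≠ 0) (k : ℝ) (X : Set (V n)) (v : V n) :
    v ∈ sRefl α k '' X ↔ sRefl α k v ∈ X := by
  constructor
  · rintro ⟨w, hw, rfl⟩
    rwa [sRefl_invol α h]
  · intro hv
    exact ⟨_, hv, sRefl_invol α h k v⟩

lemma isFace_refl (D : RootData n) {α : V n} (hα : α ∈ D.Φ) (k : ℤ) {F : Set (V n)}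
    (hF : IsFace D F) : IsFace D (sRefl α k '' F) := by
  have h := inner_self_ne D hα
  obtain ⟨v, rfl⟩ := hF
  refine ⟨sRefl α k v, ?_⟩
  have h1 := (reflHomeo α h k).image_closure
    {w | ∀ α ∈ D.Φ, ∀ k : ℤ, (⟪α, w⟫ = (k : ℝ) ↔ ⟪α, v⟫ = (k : ℝ)) ∧
      (⟪α, w⟫ < (k : ℝ) ↔ ⟪α, v⟫ < (k : ℝ))}
  refine h1.trans ?_
  congr 1
  have hcell : ∀ w v : V n, (∀ β ∈ D.Φ, ∀ m : ℤ, (⟪β, w⟫ = (m : ℝ) ↔ ⟪β, v⟫ = (m : ℝ)) ∧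
      (⟪β, w⟫ < (m : ℝ) ↔ ⟪β, v⟫ < (m : ℝ))) →
      (∀ β ∈ D.Φ, ∀ m : ℤ, (⟪β, sRefl α k w⟫ = (m : ℝ) ↔ ⟪β, sRefl α k v⟫ = (m : ℝ)) ∧
      (⟪β, sRefl α k w⟫ < (m : ℝ) ↔ ⟪β, sRefl α k v⟫ < (m : ℝ))) := by
    intro w v hwv β hβ m
    obtain ⟨β', hβ', j, h1, _⟩ := refl_key D hα k hβ
    have := hwv β' hβ' (m - j)
    rw [h1, h1]
    push_cast at this
    rwa [eq_sub_iff_add_eq, eq_sub_iff_add_eq, lt_sub_iff_add_lt, lt_sub_iff_add_lt] at this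
  ext w
  refine (image_mem_iff α h k _ w).trans ⟨fun hw => ?_, fun hw => ?_⟩
  · have := hcell _ _ hw
    rw [sRefl_invol α h] at this
    exact this
  · have := hcell _ _ hw
    rw [sRefl_invol α h] at this
    exact this

lemma mem_wall_compl (D : RootData n) (v : V n) :
    v ∈ (wallUnion D)ᶜ ↔ ∀ β ∈ D.Φ, ∀ m : ℤ, (⟪β, v⟫ : ℝ) ≠ m := by
  simp [wallUnion, Hy]

lemma wall_compl_refl (D : RootData n) {α : V n} (hα : α ∈ D.Φ) (k : ℤ) :
    sRefl α k '' (wallUnion D)ᶜ = (wallUnion D)ᶜ := by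
  have h := inner_self_ne D hα
  have h1 : ∀ v ∈ (wallUnion D)ᶜ, sRefl α k v ∈ (wallUnion D)ᶜ := by
    intro v hv
    rw [mem_wall_compl] at hv ⊢
    intro β hβ m
    obtain ⟨β', hβ', j, h1, _⟩ := refl_key D hα k hβ
    have := hv β' hβ' (m - j)
    rw [h1]
    push_cast at this
    intro h2
    exact this (by linarith)
  ext v
  rw [image_mem_iff α h]
  refine ⟨fun hv => ?_, h1 v⟩
  have := h1 _ hv
  rwa [sRefl_invol α h] at this

lemma isAlcove_refl (D : RootData n) {α : V n} (hα : α ∈ D.Φ) (k : ℤ) {c : Set (V n)}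
    (hc : IsAlcove D c) : IsAlcove D (sRefl α k '' c) := by
  have h := inner_self_ne D hα
  obtain ⟨v, hv, rfl⟩ := hc
  refine ⟨sRefl α k v, ?_, ?_⟩
  · rw [← wall_compl_refl D hα k]; exact ⟨v, hv, rfl⟩
  · have h1 := (reflHomeo α h k).image_closure (connectedComponentIn (wallUnion D)ᶜ v)
    refine h1.trans ?_
    rw [(reflHomeo α h k).image_connectedComponentIn hv]
    have : (reflHomeo α h k) '' (wallUnion D)ᶜ = (wallUnion D)ᶜ := wall_compl_refl D hα k
    rw [this]
    rfl

lemma hyperplanes_refl (D : RootData n) {α : V n} (hα : α ∈ D.Φ) (k : ℤ) {H : Set (V n)}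
    (hH : H ∈ hyperplanes D) : sRefl α k '' H ∈ hyperplanes D := by
  have h := inner_self_ne D hα
  obtain ⟨β, hβ, m, rfl⟩ := hH
  obtain ⟨β', hβ', j, h1, _⟩ := refl_key D hα k hβ
  refine ⟨β', hβ', m - j, ?_⟩
  ext v
  rw [image_mem_iff α h]
  simp only [Hy, Set.mem_ofPred_eq, h1]
  push_cast
  rw [eq_sub_iff_add_eq]

lemma isPanel_refl (D : RootData n) {α : V n} (hα : α ∈ D.Φ) (k : ℤ) {p c : Set (V n)}
    (hp : IsPanelOf D p c) : IsPanelOf D (sRefl α k '' p) (sRefl α k '' c) := by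
  have h := inner_self_ne D hα
  have hinj : Function.Injective (sRefl α (k : ℝ)) := (reflHomeo α h k).injective
  obtain ⟨h1, h2, ⟨H, hH, rfl⟩, K, ⟨hK, hK1⟩, hK2⟩ := hp
  refine ⟨isAlcove_refl D hα k h1, isFace_refl D hα k h2,
    ⟨_, hyperplanes_refl D hα k hH, Set.image_inter hinj⟩,
    sRefl α k '' K, ⟨hyperplanes_refl D hα k hK, Set.image_mono hK1⟩, ?_⟩
  rintro L ⟨hL, hL1⟩
  have h3 : c ∩ H ⊆ sRefl α k '' L := by
    have := Set.image_mono (f := sRefl α (k : ℝ)) hL1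
    rwa [image_invol α h] at this
  rw [← hK2 _ ⟨hyperplanes_refl D hα k hL, h3⟩, image_invol α h]

lemma alcove_side (D : RootData n) {α : V n} (hα : α ∈ D.Φ) (k : ℤ) {c : Set (V n)}
    (hc : IsAlcove D c) : c ⊆ Hge α k ∨ c ⊆ Hle α k := by
  obtain ⟨v, hv, rfl⟩ := hc
  have hcont : Continuous fun w : V n => (⟪α, w⟫ : ℝ) := by fun_prop
  have hpre := (isPreconnected_connectedComponentIn (F := (wallUnion D)ᶜ) (x := v)).image _
    hcont.continuousOn
  have hno : (k : ℝ) ∉ (fun w : V n => (⟪α, w⟫ : ℝ)) '' connectedComponentIn (wallUnion D)ᶜ v := by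
    rintro ⟨w, hw, hwk⟩
    exact (mem_wall_compl D w).mp (connectedComponentIn_subset _ _ hw) α hα k hwk
  have hvm := mem_connectedComponentIn hv
  have hord := hpre.ordConnected
  rcases le_total (k : ℝ) ⟪α, v⟫ with h | h
  · left
    refine closure_minimal (fun w hw => ?_) (isClosed_le continuous_const hcont)
    by_contra hcon
    have hlt : (⟪α, w⟫ : ℝ) ≤ k := (not_le.mp hcon).le
    exact hno (hord.out ⟨w, hw, rfl⟩ ⟨v, hvm, rfl⟩ ⟨hlt, h⟩)
  · right
    refine closure_minimal (fun w hw => ?_) (isClosed_le hcont continuous_const)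
    by_contra hcon
    have hlt : (k : ℝ) ≤ ⟪α, w⟫ := (not_le.mp hcon).le
    exact hno (hord.out ⟨v, hvm, rfl⟩ ⟨w, hw, rfl⟩ ⟨h, hlt⟩)

lemma alcove_not_sub (D : RootData n) {α : V n} (hα : α ∈ D.Φ) (k : ℤ) {c : Set (V n)}
    (hc : IsAlcove D c) : ¬ c ⊆ Hy α k := by
  obtain ⟨v, hv, rfl⟩ := hc
  intro h
  exact (mem_wall_compl D v).mp hv α hα k (h (subset_closure (mem_connectedComponentIn hv)))

lemma sub_Hy {α : V n} {k : ℝ} {X : Set (V n)} (h1 : X ⊆ Hge α k) (h2 : X ⊆ Hle α k) :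
    X ⊆ Hy α k := fun _ hv => le_antisymm (h2 hv) (h1 hv)

/-! ### Orientations -/

lemma Hy_eq {α β : V n} (h : (⟪α, α⟫ : ℝ) ≠ 0) (h' : β ≠ 0) {k m : ℝ} (he : Hy β m = Hy α k) :
    ∃ t : ℝ, t ≠ 0 ∧ β = t • α ∧ m = t * k := by
  have hv : ∀ v : V n, (⟪α, v⟫ : ℝ) = k → (⟪β, v⟫ : ℝ) = m := fun v hv => by
    have : v ∈ Hy β m := by rw [he]; exact hv
    exact this
  have h0 := hv ((k / ⟪α, α⟫ : ℝ) • α) (by rw [inner_smul_right]; field_simp)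
  set w : V n := β - (⟪α, β⟫ / ⟪α, α⟫ : ℝ) • α with hw
  have hwα : (⟪α, w⟫ : ℝ) = 0 := by
    rw [hw, inner_sub_right, inner_smul_right]; field_simp; ring
  have h1 := hv ((k / ⟪α, α⟫ : ℝ) • α + w) (by
    rw [inner_add_right, hwα, inner_smul_right]; field_simp; ring)
  rw [inner_add_right, h0] at h1
  have hβw : (⟪β, w⟫ : ℝ) = 0 := by linarith
  have hww : (⟪w, w⟫ : ℝ) = 0 := by
    conv_lhs => rw [hw]
    rw [inner_sub_left, inner_smul_left, hβw, hwα]; simp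
  have hw0 : w = 0 := inner_self_eq_zero.mp hww
  have hβ : β = (⟪α, β⟫ / ⟪α, α⟫ : ℝ) • α := by rw [hw] at hw0; exact sub_eq_zero.mp hw0
  refine ⟨_, ?_, hβ, ?_⟩
  · intro ht; rw [ht, zero_smul] at hβ; exact h' hβ
  · rw [← h0, inner_smul_right, real_inner_comm α β]; field_simp

lemma sameSide_smul {α : V n} {k t : ℝ} (ht : t ≠ 0) {X Y : Set (V n)}
    (h : sameSide (t • α) (t * k) X Y) : sameSide α k X Y := by
  rcases lt_or_gt_of_ne ht with h0 | h0
  · have e1 : Hge (t • α) (t * k) = Hle α k := by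
      ext v; simp [Hge, Hle, inner_smul_left, mul_le_mul_left_of_neg h0]
    have e2 : Hle (t • α) (t * k) = Hge α k := by
      ext v; simp [Hge, Hle, inner_smul_left, mul_le_mul_left_of_neg h0]
    unfold sameSide at h
    rw [e1, e2] at h
    exact h.symm
  · have e1 : Hge (t • α) (t * k) = Hge α k := by
      ext v; simp [Hge, inner_smul_left, mul_le_mul_iff_right₀ h0]
    have e2 : Hle (t • α) (t * k) = Hle α k := by
      ext v; simp [Hle, inner_smul_left, mul_le_mul_iff_right₀ h0]
    unfold sameSide at h
    rw [e1, e2] at h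
    exact h

/-- Orientation on a panel contained in `H_{α,k}`. -/
lemma orient_on (D : RootData n) {α : V n} (hα : α ∈ D.Φ) (k : ℤ) {A p c c' : Set (V n)}
    (hp : IsPanelOf D p c') (hpH : p ⊆ Hy α k) (hss : ¬ sameSide α k c A) :
    alcoveOrient D A c p := by
  intro β hβ m hpm hs
  obtain ⟨_, _, _, K, _, hK⟩ := hp
  have e1 := hK _ ⟨⟨α, hα, k, rfl⟩, hpH⟩
  have e2 := hK _ ⟨⟨β, hβ, m, rfl⟩, hpm⟩
  obtain ⟨t, ht, rfl, hm⟩ := Hy_eq (inner_self_ne D hα) (D.nonzero β hβ) (e2.trans e1.symm)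
  rw [hm] at hs
  exact hss (sameSide_smul ht hs)

/-- Equivariance of orientations. -/
lemma orient_refl (D : RootData n) {α : V n} (hα : α ∈ D.Φ) (k : ℤ) {A p c : Set (V n)}
    (h : alcoveOrient D A c p) :
    alcoveOrient D (sRefl α k '' A) (sRefl α k '' c) (sRefl α k '' p) := by
  intro β hβ m hpm hs
  obtain ⟨β', hβ', j, h1, _⟩ := refl_key D hα k hβ
  refine h β' hβ' (m - j) ?_ ?_
  · intro v hv
    have := hpm ⟨v, hv, rfl⟩
    simp only [Hy, Set.mem_ofPred_eq, h1] at this ⊢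
    push_cast; linarith
  · have hge : ∀ X : Set (V n), sRefl α k '' X ⊆ Hge β m → X ⊆ Hge β' ((m - j : ℤ) : ℝ) := by
      intro X hX v hv
      have := hX ⟨v, hv, rfl⟩
      simp only [Hge, Set.mem_ofPred_eq, h1] at this ⊢
      push_cast; linarith
    have hle : ∀ X : Set (V n), sRefl α k '' X ⊆ Hle β m → X ⊆ Hle β' ((m - j : ℤ) : ℝ) := by
      intro X hX v hv
      have := hX ⟨v, hv, rfl⟩
      simp only [Hle, Set.mem_ofPred_eq, h1] at this ⊢
      push_cast; linarith
    exact hs.imp (fun h => ⟨hge _ h.1, hge _ h.2⟩) (fun h => ⟨hle _ h.1, hle _ h.2⟩)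

/-- Adjacent alcoves induce the same orientation away from the separating hyperplane. -/
lemma orient_off (D : RootData n) {α : V n} (k : ℝ) {A B p c : Set (V n)}
    (hA : ∀ β ∈ D.Φ, ∀ m : ℤ, A ⊆ Hge β m ∨ A ⊆ Hle β m)
    (hB : ∀ β ∈ D.Φ, ∀ m : ℤ, ¬ B ⊆ Hy β m)
    (huniq : ∀ β ∈ D.Φ, ∀ m : ℤ, Separates β m A B → Hy β m = Hy α k)
    (hp : ¬ p ⊆ Hy α k) (h : alcoveOrient D A c p) : alcoveOrient D B c p := by
  intro β hβ m hpm hs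
  have hns : ¬ Separates β m A B := fun hh => hp (huniq β hβ m hh ▸ hpm)
  apply h β hβ m hpm
  rcases hs with ⟨h1, h2⟩ | ⟨h1, h2⟩
  · exact Or.inl ⟨h1, (hA β hβ m).resolve_right fun h3 => hns (Or.inr ⟨h3, h2⟩)⟩
  · exact Or.inr ⟨h1, (hA β hβ m).resolve_left fun h3 => hns (Or.inl ⟨h3, h2⟩)⟩

/-! ### Flipping galleries -/

lemma flip_shadow (D : RootData n) {α : V n} (hα : α ∈ D.Φ) (k : ℤ) (γ γ' : PreGallery n)
    (φ φ' : Set (V n) → Set (V n) → Prop)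
    (hg : IsGallery D γ') (hst : SameTypeGallery D γ γ') (h0 : γ'.p 0 = γ.p 0)
    (hpf : PositivelyFolded φ γ')
    (hoff : ∀ c p, ¬ p ⊆ Hy α k → φ c p → φ' c p)
    (heq : ∀ c p, φ c p → φ' (sRefl α k '' c) (sRefl α k '' p))
    (L : Set ℕ)
    (ha : ∀ i, 1 ≤ i → i ≤ γ'.len → γ'.p i ⊆ Hy α k ∨ (i - 1 ∈ L ↔ i ∈ L))
    (hb : 0 ∈ L → γ'.p 0 ⊆ Hy α k)
    (hc : γ'.len ∈ L ↔ γ'.len + 1 ∈ L)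
    (he : ∀ i, 1 ≤ i → i ≤ γ'.len → γ'.p i ⊆ Hy α k →
      (flipGallery α k L γ').c (i - 1) = (flipGallery α k L γ').c i →
      φ' ((flipGallery α k L γ').c i) (γ'.p i)) :
    (flipGallery α k L γ').p (γ'.len + 1) ∈ Shadow D φ' γ := by
  have h := inner_self_ne D hα
  obtain ⟨hal, ⟨hf0, hs0⟩, ⟨hf1, hs1⟩, hpan⟩ := hg
  have hFace : ∀ i, IsFace D (γ'.p i) → IsFace D ((flipGallery α k L γ').p i) := by
    intro i hi
    by_cases hiL : i ∈ L
    · simp only [flipGallery, hiL, if_true]; exact isFace_refl D hα k hi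
    · simpa only [flipGallery, hiL, if_false] using hi
  have hfix : ∀ i, γ'.p i ⊆ Hy α k → (flipGallery α k L γ').p i = γ'.p i := by
    intro i hi
    by_cases hiL : i ∈ L
    · simp only [flipGallery, hiL, if_true]; exact image_fixed α k _ hi
    · simp only [flipGallery, hiL, if_false]
  have hpt : ∀ i j, (i ∈ L ↔ j ∈ L) → IsPanelOf D (γ'.p i) (γ'.c j) →
      IsPanelOf D ((flipGallery α k L γ').p i) ((flipGallery α k L γ').c j) := by
    intro i j hij hp
    by_cases hiL : i ∈ L
    · simp only [flipGallery, hiL, hij.mp hiL, if_true]; exact isPanel_refl D hα k hp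
    · have hjL : j ∉ L := fun hj => hiL (hij.mpr hj)
      simpa only [flipGallery, hiL, hjL, if_false] using hp
  have hpt' : ∀ i j, γ'.p i ⊆ Hy α k → IsPanelOf D (γ'.p i) (γ'.c j) →
      IsPanelOf D ((flipGallery α k L γ').p i) ((flipGallery α k L γ').c j) := by
    intro i j hi hp
    rw [hfix i hi]
    by_cases hjL : j ∈ L
    · simp only [flipGallery, hjL, if_true]
      have := isPanel_refl D hα k hp
      rwa [image_fixed α k _ hi] at this
    · simpa only [flipGallery, hjL, if_false] using hp
  have hp0 : (flipGallery α k L γ').p 0 = γ'.p 0 := by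
    by_cases hL : 0 ∈ L
    · exact hfix 0 (hb hL)
    · simp only [flipGallery, hL, if_false]
  refine ⟨flipGallery α k L γ', ⟨?_, ⟨hFace 0 hf0, ?_⟩, ⟨hFace _ hf1, ?_⟩, ?_⟩, ⟨hst.1, ?_⟩,
    hp0.trans h0, ?_, rfl⟩
  · intro i hi
    by_cases hiL : i ∈ L
    · simp only [flipGallery, hiL, if_true]; exact isAlcove_refl D hα k (hal i hi)
    · simpa only [flipGallery, hiL, if_false] using hal i hi
  · by_cases hL : 0 ∈ L
    · simp only [flipGallery, hL, if_true]; exact Set.image_mono hs0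
    · simpa only [flipGallery, hL, if_false] using hs0
  · by_cases hL : γ'.len ∈ L
    · simp only [flipGallery, hL, hc.mp hL, if_true]; exact Set.image_mono hs1
    · have hL' : γ'.len + 1 ∉ L := fun hh => hL (hc.mpr hh)
      simpa only [flipGallery, hL, hL', if_false] using hs1
  · intro i h1 h2
    have h2' : i ≤ γ'.len := h2
    obtain ⟨q1, q2⟩ := hpan i h1 h2'
    refine ⟨?_, hpt i i Iff.rfl q2⟩
    rcases ha i h1 h2' with hh | hh
    · exact hpt' i _ hh q1
    · exact hpt i _ hh.symm q1
  · intro i hi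
    obtain ⟨x, hx, hxe⟩ := hst.2 i hi
    by_cases hiL : i ∈ L
    · refine ⟨(reflHomeo α h (k : ℝ)).toEquiv * x,
        (AffW D).mul_mem (sRefl_mem_AffW D hα k) hx, ?_⟩
      simp only [flipGallery, hiL, if_true]
      rw [hxe, Set.image_image]
      rfl
    · refine ⟨x, hx, ?_⟩
      simpa only [flipGallery, hiL, if_false] using hxe
  · intro i h1 h2 hfold
    have h2' : i ≤ γ'.len := h2
    by_cases hpH : γ'.p i ⊆ Hy α k
    · rw [hfix i hpH]
      exact he i h1 h2' hpH hfold
    · have hh := (ha i h1 h2').resolve_left hpH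
      by_cases hiL : i ∈ L
      · have hiL' := hh.mpr hiL
        simp only [flipGallery, hiL, hiL', if_true] at hfold ⊢
        have hf : γ'.c (i - 1) = γ'.c i := by
          rw [← image_invol α h k (γ'.c i), ← hfold, image_invol α h]
        exact heq _ _ (hpf i h1 h2' hf)
      · have hiL' : i - 1 ∉ L := fun hx => hiL (hh.mp hx)
        simp only [flipGallery, hiL, hiL', if_false] at hfold ⊢
        have hfi := hpf i h1 h2' hfold
        exact hoff _ _ hpH hfi

/-- The recursion in the normalised situation `A ⊆ Hge`, `B ⊆ Hle`. -/
lemma recursion_core (D : RootData n) {α : V n} (hα : α ∈ D.Φ) (k : ℤ) (A B : Set (V n))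
    (hA : ∀ β ∈ D.Φ, ∀ m : ℤ, A ⊆ Hge β m ∨ A ⊆ Hle β m)
    (hB : ∀ β ∈ D.Φ, ∀ m : ℤ, B ⊆ Hge β m ∨ B ⊆ Hle β m)
    (hA' : ∀ β ∈ D.Φ, ∀ m : ℤ, ¬ A ⊆ Hy β m)
    (hB' : ∀ β ∈ D.Φ, ∀ m : ℤ, ¬ B ⊆ Hy β m)
    (huniq : ∀ β ∈ D.Φ, ∀ m : ℤ, Separates β m A B → Hy β m = Hy α k)
    (hAg : A ⊆ Hge α k) (hBl : B ⊆ Hle α k) (hBA : B = sRefl α k '' A)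
    (h00 : (0 : V n) ∈ Hge α k)
    (γ : PreGallery n) (hfirst : γ.p 0 = {(0 : V n)}) :
    VShadow D (alcoveOrient D B) γ =
      VShadow D (alcoveOrient D A) γ ∪
        sRefl α (k : ℝ) '' {μ | μ ∈ VShadow D (alcoveOrient D A) γ ∧ μ ∈ Hle α k} := by
  have h := inner_self_ne D hα
  have hAB : A = sRefl α k '' B := by rw [hBA, image_invol α h]
  have offAB : ∀ c p, ¬ p ⊆ Hy α k → alcoveOrient D A c p → alcoveOrient D B c p :=
    fun c p hp => orient_off D k hA hB' huniq hp
  have offBA : ∀ c p, ¬ p ⊆ Hy α k → alcoveOrient D B c p → alcoveOrient D A c p :=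
    fun c p hp => orient_off D k hB hA' (fun β hβ m hs => huniq β hβ m
      (hs.symm.imp (fun h => ⟨h.2, h.1⟩) (fun h => ⟨h.2, h.1⟩))) hp
  have eqAB : ∀ c p, alcoveOrient D A c p →
      alcoveOrient D B (sRefl α k '' c) (sRefl α k '' p) := by
    intro c p hcp; rw [hBA]; exact orient_refl D hα k hcp
  have eqBA : ∀ c p, alcoveOrient D B c p →
      alcoveOrient D A (sRefl α k '' c) (sRefl α k '' p) := by
    intro c p hcp; rw [hAB]; exact orient_refl D hα k hcp
  -- folds at `H` on the `A`-side are `B`-positive and conversely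
  have posB : ∀ c c' p, IsAlcove D c → IsPanelOf D p c' → p ⊆ Hy α k → c ⊆ Hge α k →
      alcoveOrient D B c p := by
    intro c c' p hc hp hpH hcg
    refine orient_on D hα k hp hpH ?_
    rintro (⟨_, h2⟩ | ⟨h1, _⟩)
    · exact hB' α hα k (sub_Hy h2 hBl)
    · exact alcove_not_sub D hα k hc (sub_Hy hcg h1)
  have posA : ∀ c c' p, IsAlcove D c → IsPanelOf D p c' → p ⊆ Hy α k → c ⊆ Hle α k →
      alcoveOrient D A c p := by
    intro c c' p hc hp hpH hcg
    refine orient_on D hα k hp hpH ?_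
    rintro (⟨h1, _⟩ | ⟨_, h2⟩)
    · exact alcove_not_sub D hα k hc (sub_Hy h1 hcg)
    · exact hA' α hα k (sub_Hy hAg h2)
  -- crossing
  have crossLe : ∀ c c' p, IsPanelOf D p c → IsPanelOf D p c' → ¬ p ⊆ Hy α k →
      c ⊆ Hle α k → c' ⊆ Hle α k := by
    intro c c' p hp hp' hpH hc
    refine (alcove_side D hα k hp'.1).resolve_left fun hg => hpH ?_
    obtain ⟨_, _, ⟨_, _, e⟩, _⟩ := hp
    obtain ⟨_, _, ⟨_, _, e'⟩, _⟩ := hp'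
    exact sub_Hy (fun v hv => hg (by rw [e'] at hv; exact hv.1))
      (fun v hv => hc (by rw [e] at hv; exact hv.1))
  have crossGe : ∀ c c' p, IsPanelOf D p c → IsPanelOf D p c' → ¬ p ⊆ Hy α k →
      c ⊆ Hge α k → c' ⊆ Hge α k := by
    intro c c' p hp hp' hpH hc
    refine (alcove_side D hα k hp'.1).resolve_right fun hg => hpH ?_
    obtain ⟨_, _, ⟨_, _, e⟩, _⟩ := hp
    obtain ⟨_, _, ⟨_, _, e'⟩, _⟩ := hp'
    exact sub_Hy (fun v hv => hc (by rw [e] at hv; exact hv.1))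
      (fun v hv => hg (by rw [e'] at hv; exact hv.1))
  have flipAlc : ∀ (γ' : PreGallery n) (L : Set ℕ) i, IsAlcove D (γ'.c i) →
      IsAlcove D ((flipGallery α k L γ').c i) := by
    intro γ' L i hi
    by_cases hiL : i ∈ L
    · simp only [flipGallery, hiL, if_true]; exact isAlcove_refl D hα k hi
    · simpa only [flipGallery, hiL, if_false] using hi
  -- start in H
  have start : ∀ γ' : PreGallery n, IsGallery D γ' → γ'.p 0 = γ.p 0 → γ'.c 0 ⊆ Hle α k →
      γ'.p 0 ⊆ Hy α k := by
    intro γ' hg hp0 hc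
    have h1 := hg.2.1.2
    rw [hp0, hfirst] at h1 ⊢
    rw [Set.singleton_subset_iff] at h1 ⊢
    exact le_antisymm (hc h1) h00
  have part1 : ∀ μ, μ ∈ VShadow D (alcoveOrient D A) γ → μ ∈ VShadow D (alcoveOrient D B) γ := by
    rintro μ ⟨γ', hg, hst, hp0, hpf, hμ⟩
    set L : Set ℕ := {i | γ'.c i ⊆ Hle α k ∧ ∃ j, i < j ∧ j ≤ γ'.len ∧ γ'.p j ⊆ Hy α k} with hL
    have hl1 : γ'.len ∉ L := by rintro ⟨_, j, h1, h2, _⟩; omega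
    have hl2 : γ'.len + 1 ∉ L := by rintro ⟨_, j, h1, h2, _⟩; omega
    have := flip_shadow D hα k γ γ' (alcoveOrient D A) (alcoveOrient D B) hg hst hp0 hpf
      offAB eqAB L ?_ (fun hh => start γ' hg hp0 hh.1) (by simp only [hl1, hl2]) ?_
    · simp only [flipGallery, hl2, if_false] at this
      show {μ} ∈ Shadow _ _ _
      rw [hμ]; exact this
    · intro i h1 h2
      by_cases hpH : γ'.p i ⊆ Hy α k
      · exact Or.inl hpH
      right
      obtain ⟨q1, q2⟩ := hg.2.2.2 i h1 h2
      constructor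
      · rintro ⟨hc, j, j1, j2, j3⟩
        refine ⟨crossLe _ _ _ q1 q2 hpH hc, j, ?_, j2, j3⟩
        have : j ≠ i := by rintro rfl; exact hpH j3
        omega
      · rintro ⟨hc, j, j1, j2, j3⟩
        exact ⟨crossLe _ _ _ q2 q1 hpH hc, j, by omega, j2, j3⟩
    · intro i h1 h2 hpH hfold
      refine posB _ _ _ (flipAlc _ _ _ (hg.1 i h2)) (hg.2.2.2 i h1 h2).2 hpH ?_
      rw [← hfold]
      by_cases hc : γ'.c (i - 1) ⊆ Hle α k
      · have hiL : i - 1 ∈ L := ⟨hc, i, by omega, h2, hpH⟩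
        simp only [flipGallery, hiL, if_true]
        exact image_le α h k _ hc
      · have hiL : i - 1 ∉ L := fun hh => hc hh.1
        simp only [flipGallery, hiL, if_false]
        exact (alcove_side D hα k (hg.1 _ (by omega))).resolve_right hc
  apply Set.Subset.antisymm
  · rintro μ ⟨γ', hg, hst, hp0, hpf, hμ⟩
    set L : Set ℕ := {i | γ'.c (min i γ'.len) ⊆ Hge α k ∧
      ∃ j, j ≤ min i γ'.len ∧ γ'.p j ⊆ Hy α k} with hL
    have hlL : γ'.len ∈ L ↔ γ'.len + 1 ∈ L := by
      have e1 : min (γ'.len + 1) γ'.len = γ'.len := by omega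
      simp only [hL, Set.mem_ofPred_eq, e1, min_self]
    have := flip_shadow D hα k γ γ' (alcoveOrient D B) (alcoveOrient D A) hg hst hp0 hpf
      offBA eqBA L ?_ ?_ hlL ?_
    · by_cases hl : γ'.len + 1 ∈ L
      · right
        simp only [flipGallery, hl, if_true] at this
        rw [← hμ, Set.image_singleton] at this
        refine ⟨sRefl α k μ, ⟨this, ?_⟩, sRefl_invol α h k μ⟩
        have hc := (hlL.mpr hl).1
        rw [min_self] at hc
        have h1 : ({μ} : Set (V n)) ⊆ Hge α k := by rw [hμ]; exact hg.2.2.1.2.trans hc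
        have h2 := image_ge α h k _ h1
        rw [Set.image_singleton, Set.singleton_subset_iff] at h2
        exact h2
      · left
        simp only [flipGallery, hl, if_false] at this
        show {μ} ∈ Shadow _ _ _
        rw [hμ]; exact this
    · intro i h1 h2
      by_cases hpH : γ'.p i ⊆ Hy α k
      · exact Or.inl hpH
      right
      obtain ⟨q1, q2⟩ := hg.2.2.2 i h1 h2
      have e1 : min (i - 1) γ'.len = i - 1 := by omega
      have e2 : min i γ'.len = i := by omega
      constructor
      · rintro ⟨hc, j, j1, j3⟩
        rw [e1] at hc j1
        refine ⟨?_, j, ?_, j3⟩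
        · rw [e2]; exact crossGe _ _ _ q1 q2 hpH hc
        · omega
      · rintro ⟨hc, j, j1, j3⟩
        rw [e2] at hc j1
        refine ⟨?_, j, ?_, j3⟩
        · rw [e1]; exact crossGe _ _ _ q2 q1 hpH hc
        · have : j ≠ i := by rintro rfl; exact hpH j3
          omega
    · rintro ⟨_, j, j1, j2⟩
      have : j = 0 := by omega
      rwa [this] at j2
    · intro i h1 h2 hpH _
      refine posA _ _ _ (flipAlc _ _ _ (hg.1 i h2)) (hg.2.2.2 i h1 h2).2 hpH ?_
      have e2 : min i γ'.len = i := by omega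
      by_cases hc : γ'.c i ⊆ Hge α k
      · have hiL : i ∈ L := ⟨by rw [e2]; exact hc, i, by omega, hpH⟩
        simp only [flipGallery, hiL, if_true]
        exact image_ge α h k _ hc
      · have hiL : i ∉ L := fun hh => hc (by have := hh.1; rwa [e2] at this)
        simp only [flipGallery, hiL, if_false]
        exact (alcove_side D hα k (hg.1 _ h2)).resolve_left hc
  · rintro ν (hν | ⟨μ, ⟨hμS, hμH⟩, rfl⟩)
    · exact part1 ν hν
    obtain ⟨γ', hg, hst, hp0, hpf, hμ⟩ := id hμS
    by_cases hcl : γ'.c γ'.len ⊆ Hle α k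
    swap
    · have hcg := (alcove_side D hα k (hg.1 _ le_rfl)).resolve_right hcl
      have h1 : ({μ} : Set (V n)) ⊆ Hge α k := by rw [hμ]; exact hg.2.2.1.2.trans hcg
      rw [Set.singleton_subset_iff] at h1
      rw [sRefl_fixed α k μ (le_antisymm hμH h1)]
      exact part1 μ hμS
    set L : Set ℕ := {i | γ'.c (min i γ'.len) ⊆ Hle α k} with hL
    have hlL : γ'.len ∈ L ↔ γ'.len + 1 ∈ L := by simp [hL]
    have hl1 : γ'.len ∈ L := by
      show γ'.c (min _ _) ⊆ _
      rw [min_self]; exact hcl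
    have := flip_shadow D hα k γ γ' (alcoveOrient D A) (alcoveOrient D B) hg hst hp0 hpf
      offAB eqAB L ?_ ?_ hlL ?_
    · simp only [flipGallery, hlL.mp hl1, if_true] at this
      rw [← hμ, Set.image_singleton] at this
      exact this
    · intro i h1 h2
      by_cases hpH : γ'.p i ⊆ Hy α k
      · exact Or.inl hpH
      right
      obtain ⟨q1, q2⟩ := hg.2.2.2 i h1 h2
      have e1 : min (i - 1) γ'.len = i - 1 := by omega
      have e2 : min i γ'.len = i := by omega
      show γ'.c (min _ _) ⊆ _ ↔ γ'.c (min _ _) ⊆ _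
      rw [e1, e2]
      exact ⟨crossLe _ _ _ q1 q2 hpH, crossLe _ _ _ q2 q1 hpH⟩
    · intro hh
      refine start γ' hg hp0 ?_
      have hh' : γ'.c (min 0 γ'.len) ⊆ Hle α k := hh
      rwa [Nat.zero_min] at hh'
    · intro i h1 h2 hpH _
      refine posB _ _ _ (flipAlc _ _ _ (hg.1 i h2)) (hg.2.2.2 i h1 h2).2 hpH ?_
      have e2 : min i γ'.len = i := by omega
      by_cases hc : γ'.c i ⊆ Hle α k
      · have hiL : i ∈ L := by
          show γ'.c (min _ _) ⊆ _
          rw [e2]; exact hc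
        simp only [flipGallery, hiL, if_true]
        exact image_le α h k _ hc
      · have hiL : i ∉ L := fun hh => hc (by
          have hh' : γ'.c (min i γ'.len) ⊆ Hle α k := hh
          rwa [e2] at hh')
        simp only [flipGallery, hiL, if_false]
        exact (alcove_side D hα k (hg.1 _ h2)).resolve_right hc

lemma recursion_norm (D : RootData n) (y s : AffW D) (hs : s ∈ SGen D)
    (hlen : lenW D y < lenW D (y * s)) {α : V n} (hα : α ∈ D.Φ) (k : ℤ)
    (hAg : actW y (fund D) ⊆ Hge α k) (hBl : actW (y * s) (fund D) ⊆ Hle α k)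
    (γ : PreGallery n) (hfirst : γ.p 0 = {(0 : V n)}) :
    VShadow D (alcoveOrient D (actW (y * s) (fund D))) γ =
      VShadow D (alcoveOrient D (actW y (fund D))) γ ∪
        sRefl α (k : ℝ) ''
          {μ | μ ∈ VShadow D (alcoveOrient D (actW y (fund D))) γ ∧ μ ∈ Hle α k} := by
  have hsc := sep_conj D y s hs hα k (Or.inl ⟨hAg, hBl⟩)
  refine recursion_core D hα k _ _ (fun β hβ m => actW_side D y hβ m)
    (fun β hβ m => actW_side D _ hβ m) (fun β hβ m => actW_not_sub D y hβ m)
    (fun β hβ m => actW_not_sub D _ hβ m) ?_ hAg hBl ?_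
    (fund_same_side D y s hs hlen hα k hAg hBl (zero_mem_fund D)) γ hfirst
  · intro β hβ m hsep
    have h2 := sep_conj D y s hs hβ m hsep
    have h3 : ∀ v, sRefl β m v = sRefl α k v := by
      intro v
      obtain ⟨w, rfl⟩ := (y : Equiv.Perm (V n)).surjective v
      rw [h2, hsc]
    ext v
    rw [← sRefl_fixed_iff β (inner_self_ne D hβ), ← sRefl_fixed_iff α (inner_self_ne D hα), h3]
  · rw [actW_mul, actW, actW, actW, Set.image_image, Set.image_image]
    exact Set.image_congr fun v _ => (hsc v).symm

lemma Hge_neg (α : V n) (k : ℝ) : Hge (-α) (-k) = Hle α k := by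
  ext v; simp [Hge, Hle, inner_neg_left]

lemma Hle_neg (α : V n) (k : ℝ) : Hle (-α) (-k) = Hge α k := by
  ext v; simp [Hge, Hle, inner_neg_left]

end ShadowProof

/-- Theorem: recursive description of shadows of coroot lattice elements. -/
theorem shadow_recursion_vertex {n : ℕ} (D : RootData n)
    (lam : V n) (hlam : lam ∈ corootLattice D)
    (y s : AffW D) (hs : s ∈ SGen D) (hlen : lenW D y < lenW D (y * s))
    (α : V n) (hα : α ∈ D.Φ) (k : ℤ)
    (hsep : Separates α (k : ℝ) (actW y (fund D)) (actW (y * s) (fund D)))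
    (Hys : Set (V n))
    (hHys : (Hys = Hge α (k : ℝ) ∧ actW (y * s) (fund D) ⊆ Hge α (k : ℝ)) ∨
            (Hys = Hle α (k : ℝ) ∧ actW (y * s) (fund D) ⊆ Hle α (k : ℝ)))
    (γ : PreGallery n) (hmin : IsMinimal D γ)
    (hfirst : γ.p 0 = {(0 : V n)}) (hlast : γ.p (γ.len + 1) = {lam}) :
    VShadow D (alcoveOrient D (actW (y * s) (fund D))) γ =
      VShadow D (alcoveOrient D (actW y (fund D))) γ ∪
        sRefl α (k : ℝ) ''
          {μ | μ ∈ VShadow D (alcoveOrient D (actW y (fund D))) γ ∧ μ ∈ Hys} := by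
  rcases hsep with ⟨h1, h2⟩ | ⟨h1, h2⟩
  · have hH : Hys = Hle α k := by
      rcases hHys with ⟨_, h3⟩ | ⟨h3, _⟩
      · exact absurd (sub_Hy h3 h2) (actW_not_sub D _ hα _)
      · exact h3
    rw [hH]
    exact recursion_norm D y s hs hlen hα k h1 h2 γ hfirst
  · have hH : Hys = Hge α k := by
      rcases hHys with ⟨h3, _⟩ | ⟨_, h3⟩
      · exact h3
      · exact absurd (sub_Hy h2 h3) (actW_not_sub D _ hα _)
    rw [hH]
    have := recursion_norm D y s hs hlen (D.neg_mem α hα) (-k)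
      (by push_cast; rw [Hge_neg]; exact h1) (by push_cast; rw [Hle_neg]; exact h2) γ hfirst
    push_cast at this
    rw [Hle_neg, sRefl_neg] at this
    exact this
end
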